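/- arXiv:2505.04213 — 13 statements merged into one kernel-verified Lean document; each statement's English description precedes it below -/
import Mathlib

section
/- Let g, Δ ∈ 𝔽_q[T] with Δ ≠ 0, and let φ be the rank 2 Drinfeld module with φ_T(x) = T·x + g·x^q + Δ·x^{q²}. Let N be the least common multiple of the degrees of the monic irreducible divisors of Δ (N = 1 if Δ is constant). Assume that φ_T(1) = T + g + Δ is coprime to TΔ in 𝔽_q[T], and let x ∈ 𝔽_q[T] be coprime to TΔ and not a torsion point of φ. Then every n in the Zsigmondy set Z(φ,x) satisfies n ≤ (6(q^{2N} − 1)·N·|S| + 4) + (1/2)·log_q(2 + 2·deg g + 2·deg Δ). -/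
open Polynomial UniqueFactorizationMonoid Filter

/-- The multiplicity of the monic irreducible polynomial `P` in the factorization of `f`. -/
noncomputable def ordP {Fq : Type*} [Field Fq] [DecidableEq Fq] (P f : Polynomial Fq) : ℕ :=
  letI := Classical.decEq (Polynomial Fq)
  (normalizedFactors f).count P

/-- The number of distinct monic irreducible factors of `f`. -/
noncomputable def numMonicIrredFactors {Fq : Type*} [Field Fq] [DecidableEq Fq]
    (f : Polynomial Fq) : ℕ :=
  letI := Classical.decEq (Polynomial Fq)
  (normalizedFactors f).toFinset.card

/-- The least common multiple of the degrees of the monic irreducible factors of `f`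
(this equals `1` when `f` is a nonzero constant). -/
noncomputable def lcmDegFactors {Fq : Type*} [Field Fq] [DecidableEq Fq]
    (f : Polynomial Fq) : ℕ :=
  letI := Classical.decEq (Polynomial Fq)
  (normalizedFactors f).toFinset.lcm Polynomial.natDegree

/-- Explicit Zsigmondy bound for the rank 2 Drinfeld module
`φ_T(x) = T·x + g·x^q + Δ·x^{q²}`: if `φ_T(1) = T + g + Δ` is coprime to `TΔ` and
`x ∈ 𝔽_q[T]` is coprime to `TΔ` and not a torsion point of `φ`, then every `n ≥ 1`
such that `𝔄_n = φ_{T^n}(x)` has no primitive divisor satisfies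
`n ≤ (6(q^{2N} − 1)·N·|S| + 4) + (1/2)·log_q(2 + 2 deg g + 2 deg Δ)`. -/
theorem zsigmondy_bound_rank_two_general
    {Fq : Type*} [Field Fq] [Fintype Fq] [DecidableEq Fq]
    (q : ℕ) (hq : q = Fintype.card Fq)
    (g Δ : Polynomial Fq) (hΔ : Δ ≠ 0)
    (φ : Polynomial Fq → Polynomial Fq)
    (hφ : ∀ y, φ y = Polynomial.X * y + g * y ^ q + Δ * y ^ q ^ 2)
    (N : ℕ) (hN : N = lcmDegFactors Δ)
    (S : ℕ) (hS : S = 1 + numMonicIrredFactors (Polynomial.X * Δ))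
    (hcop : IsCoprime (Polynomial.X + g + Δ) (Polynomial.X * Δ))
    (x : Polynomial Fq) (hx : IsCoprime x (Polynomial.X * Δ))
    (htor : ¬ (Set.range fun n => φ^[n] x).Finite)
    (n : ℕ) (hn : 1 ≤ n)
    (hnoprim : ¬ ∃ P : Polynomial Fq, Irreducible P ∧ P ∣ φ^[n] x ∧ ∀ i < n, ¬ P ∣ φ^[i] x) :
    (n : ℝ) ≤ (6 * ((q : ℝ) ^ (2 * N) - 1) * (N : ℝ) * (S : ℝ) + 4)
      + (1 / 2) * Real.logb q (2 + 2 * (g.natDegree : ℝ) + 2 * (Δ.natDegree : ℝ)) := by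
  have hq2 : 2 ≤ q := by rw [hq]; exact Fintype.one_lt_card
  have hsucc : ∀ i, φ^[i+1] x = φ (φ^[i] x) := fun i => Function.iterate_succ_apply' φ i x
  -- the orbit is injective
  have hlt : ∀ i j, i < j → φ^[i] x ≠ φ^[j] x := by
    intro i j hij heq
    apply htor
    have key : ∀ m, ∃ k < j, φ^[m] x = φ^[k] x := by
      intro m
      induction m with
      | zero => exact ⟨0, by omega, rfl⟩
      | succ m ih =>
        obtain ⟨k, hk, hkm⟩ := ih
        rcases Nat.lt_or_ge (k+1) j with h | h
        · exact ⟨k+1, h, by rw [hsucc, hsucc, hkm]⟩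
        · have : k + 1 = j := by omega
          exact ⟨i, hij, by rw [hsucc, hkm, ← hsucc, this, heq]⟩
    apply ((Set.finite_Iio j).image (fun k => φ^[k] x)).subset
    rintro _ ⟨m, rfl⟩
    obtain ⟨k, hk, hkm⟩ := key m
    exact ⟨k, hk, hkm.symm⟩
  have hinj : Function.Injective (fun i => φ^[i] x) := by
    intro i j hij
    rcases lt_trichotomy i j with h | h | h
    · exact (hlt i j h hij).elim
    · exact h
    · exact (hlt j i h hij.symm).elim
  have hfac : ∀ y, φ y = y * (X + y * (g * y ^ (q - 2) + Δ * y ^ (q ^ 2 - 2))) := by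
    intro y
    rw [hφ]
    have h1 : y ^ q = y ^ (q - 2) * y ^ 2 := by rw [← pow_add]; congr 1; omega
    have h2 : y ^ q ^ 2 = y ^ (q ^ 2 - 2) * y ^ 2 := by
      rw [← pow_add]; congr 1
      have : 2 ≤ q ^ 2 := by nlinarith
      omega
    rw [h1, h2]; ring
  have hdvd1 : ∀ i, φ^[i] x ∣ φ^[i+1] x := fun i => by
    rw [hsucc, hfac]; exact dvd_mul_right _ _
  have hdvd : ∀ i j, i ≤ j → φ^[i] x ∣ φ^[j] x := by
    intro i j hij
    induction j, hij using Nat.le_induction with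
    | base => exact dvd_rfl
    | succ j _ ih => exact ih.trans (hdvd1 j)
  have hne : ∀ i, φ^[i] x ≠ 0 := by
    intro i h0
    apply hlt i (i+1) (by omega)
    rw [hsucc, hfac, h0, zero_mul]
  -- `X` never divides a term of the orbit
  have hroot : ∀ f : Polynomial Fq, IsCoprime f (X * Δ) → f.eval 0 ≠ 0 := by
    intro f hf h0
    obtain ⟨a, b, hab⟩ := hf
    have := congrArg (Polynomial.eval 0) hab
    simp [h0] at this
  have hX : ∀ i, (φ^[i] x).eval 0 ≠ 0 := by
    intro i
    induction i with
    | zero => exact hroot x hx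
    | succ i ih =>
      have hc := hroot _ hcop
      rw [hsucc, hφ]
      have e1 : ∀ a : Fq, a ^ q = a := fun a => by rw [hq]; exact FiniteField.pow_card a
      have e2 : ∀ a : Fq, a ^ q ^ 2 = a := fun a => by rw [pow_two, pow_mul, e1, e1]
      simp only [eval_add, eval_mul, eval_pow, eval_X, e1, e2, zero_mul, zero_add] at hc ⊢
      rw [← add_mul]
      exact mul_ne_zero hc ih
  obtain ⟨m, rfl⟩ : ∃ m, n = m + 1 := ⟨n - 1, by omega⟩
  set A := φ^[m] x with hA
  set B := g * A ^ (q - 2) + Δ * A ^ (q ^ 2 - 2) with hB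
  have hAn : φ^[m+1] x = A * (X + A * B) := by rw [hsucc, hfac]
  have hunit : IsUnit (X + A * B) := by
    by_contra hnu
    have hu0 : X + A * B ≠ 0 := by
      intro h0
      apply hne (m+1)
      rw [hAn, h0, mul_zero]
    obtain ⟨P, hP, hPu⟩ := WfDvdMonoid.exists_irreducible_factor hnu hu0
    apply hnoprim
    refine ⟨P, hP, hAn ▸ hPu.mul_left A, ?_⟩
    intro i hi hPi
    have hPA : P ∣ A := hPi.trans (hdvd i m (by omega))
    have hPX : P ∣ X := (dvd_add_left (hPA.mul_right B)).1 hPu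
    have hXP : X ∣ P := (hP.associated_of_dvd irreducible_X hPX).symm.dvd
    have := hXP.trans hPA
    rw [X_dvd_iff, coeff_zero_eq_eval_zero] at this
    exact hX m this
  obtain ⟨c, -, hc⟩ := Polynomial.isUnit_iff.1 hunit
  have hAdvd : A ∣ X - C c := ⟨-B, by rw [hc]; ring⟩
  have hdeg : ∀ i ≤ m, (φ^[i] x).natDegree ≤ 1 := by
    intro i hi
    have := Polynomial.natDegree_le_of_dvd ((hdvd i m hi).trans hAdvd) (X_sub_C_ne_zero c)
    simpa using this
  have hcard : m + 1 ≤ q ^ 2 := by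
    let F : Fin (m+1) → Fq × Fq := fun i => ((φ^[i] x).coeff 0, (φ^[i] x).coeff 1)
    have hF : Function.Injective F := by
      intro i j hij
      have h0 := congrArg Prod.fst hij
      have h1 := congrArg Prod.snd hij
      apply Fin.ext
      apply hinj
      show φ^[i] x = φ^[j] x
      rw [Polynomial.eq_X_add_C_of_natDegree_le_one (hdeg i (by omega)),
        Polynomial.eq_X_add_C_of_natDegree_le_one (hdeg j (by omega))]
      simp only [F] at h0 h1
      rw [h0, h1]
    have := Fintype.card_le_of_injective F hF
    rw [Fintype.card_fin, Fintype.card_prod, ← hq] at this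
    rw [pow_two]; exact this
  have hN1 : 1 ≤ N := by
    rw [Nat.one_le_iff_ne_zero, hN]
    unfold lcmDegFactors
    intro h
    rw [Finset.lcm_eq_zero_iff] at h
    obtain ⟨P, hP, hP0⟩ := h
    have hirr := irreducible_of_normalized_factor P ((@Multiset.mem_toFinset _ (Classical.decEq _) _ _).1 hP)
    exact hirr.natDegree_pos.ne' hP0
  have hS1 : 1 ≤ S := by omega
  have hq2R : (2 : ℝ) ≤ q := by exact_mod_cast hq2
  have hlog : 0 ≤ Real.logb q (2 + 2 * (g.natDegree : ℝ) + 2 * (Δ.natDegree : ℝ)) := by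
    apply Real.logb_nonneg (by linarith)
    have h1 : (0:ℝ) ≤ g.natDegree := Nat.cast_nonneg _
    have h2 : (0:ℝ) ≤ Δ.natDegree := Nat.cast_nonneg _
    linarith
  have hcardR : ((m + 1 : ℕ) : ℝ) ≤ (q : ℝ) ^ 2 := by exact_mod_cast hcard
  have hpow : (q : ℝ) ^ 2 ≤ (q : ℝ) ^ (2 * N) :=
    pow_le_pow_right₀ (by linarith) (by omega)
  have hNR : (1 : ℝ) ≤ N := by exact_mod_cast hN1
  have hSR : (1 : ℝ) ≤ S := by exact_mod_cast hS1
  have hNS : (1 : ℝ) ≤ (N : ℝ) * S := one_le_mul_of_one_le_of_one_le hNR hSR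
  have hq4 : (4 : ℝ) ≤ (q : ℝ) ^ 2 := by nlinarith
  have hmain : (q : ℝ) ^ (2 * N) - 1 ≤ ((q : ℝ) ^ (2 * N) - 1) * ((N : ℝ) * S) :=
    le_mul_of_one_le_right (by linarith) hNS
  have hassoc : 6 * ((q : ℝ) ^ (2 * N) - 1) * (N : ℝ) * (S : ℝ)
      = 6 * (((q : ℝ) ^ (2 * N) - 1) * ((N : ℝ) * S)) := by ring
  rw [hassoc]
  linarith
end

section
/- Let φ_T(x) = T·x + c_1·x^q + ⋯ + c_r·x^{q^r} with c_1, …, c_r ∈ 𝔽_q[T], c_r ≠ 0, and set Θ = q^r and M_φ = (q/((Θ − 1)(q − 1)))·max{1 − deg c_r, deg c_1 − deg c_r, …, deg c_{r−1} − deg c_r, 0}. Let x ∈ 𝔽_q[T] and suppose that the sequence n ↦ h(φ_{T^n}(x))/Θ^n converges to a real number L (the canonical height ĥ(x)). Then h(x) − L ≤ M_φ. -/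
open Polynomial Filter

/-- If the canonical height `ĥ(x) = lim h(φ_{T^n}(x))/Θ^n` of `x ∈ 𝔽_q[T]` exists and
equals `L`, then `h(x) − ĥ(x) ≤ M_φ`, where
`M_φ = (q/((Θ − 1)(q − 1)))·max{1 − deg c_r, deg c_1 − deg c_r, …, deg c_{r−1} − deg c_r, 0}`. -/
theorem classical_sub_canonical_le
    {Fq : Type*} [Field Fq] [Fintype Fq]
    (q : ℕ) (hq : q = Fintype.card Fq)
    (r : ℕ) (hr : 1 ≤ r) (c : ℕ → Polynomial Fq) (hcr : c r ≠ 0)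
    (φ : Polynomial Fq → Polynomial Fq)
    (hφ : ∀ y, φ y = Polynomial.X * y + ∑ i ∈ Finset.range r, c (i + 1) * y ^ q ^ (i + 1))
    (Θ : ℕ) (hΘ : Θ = q ^ r)
    (Mφ : ℝ)
    (hM : Mφ = (q : ℝ) / (((Θ : ℝ) - 1) * ((q : ℝ) - 1))
      * (((((Finset.range r).sup fun i =>
          ((if i = 0 then (1 : ℤ) else ((c i).natDegree : ℤ)) - ((c r).natDegree : ℤ)).toNat) : ℕ) : ℝ)))
    (x : Polynomial Fq) (L : ℝ)
    (hL : Tendsto (fun n => ((φ^[n] x).natDegree : ℝ) / (Θ : ℝ) ^ n) atTop (nhds L)) :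
    (x.natDegree : ℝ) - L ≤ Mφ := by
  obtain ⟨s, rfl⟩ : ∃ s, r = s + 1 := ⟨r - 1, by omega⟩
  have hq2 : 2 ≤ q := by
    rw [hq]; exact Fintype.one_lt_card
  set m : ℕ := (Finset.range (s + 1)).sup fun i =>
          ((if i = 0 then (1 : ℤ) else ((c i).natDegree : ℤ)) - ((c (s + 1)).natDegree : ℤ)).toNat with hm
  have hmi : ∀ i ∈ Finset.range (s + 1),
      ((if i = 0 then (1 : ℤ) else ((c i).natDegree : ℤ)) - ((c (s + 1)).natDegree : ℤ)).toNat ≤ m := by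
    intro i hi
    exact Finset.le_sup (f := fun i =>
          ((if i = 0 then (1 : ℤ) else ((c i).natDegree : ℤ)) - ((c (s + 1)).natDegree : ℤ)).toNat) hi
  have hm0 : 1 ≤ m + (c (s + 1)).natDegree := by
    have := hmi 0 (by simp)
    simp only [if_true] at this
    omega
  have hmi' : ∀ i < s, (c (i + 1)).natDegree ≤ m + (c (s + 1)).natDegree := by
    intro i hi
    have := hmi (i + 1) (by simp; omega)
    simp only [Nat.succ_ne_zero, if_false] at this
    omega
  have hstep : ∀ y : Polynomial Fq, m + q ^ s * y.natDegree < q ^ (s + 1) * y.natDegree →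
      (φ y).natDegree = (c (s + 1)).natDegree + q ^ (s + 1) * y.natDegree := by
    intro y hy
    have hy0 : y ≠ 0 := by
      rintro rfl
      simp at hy
    have hlead : (c (s + 1) * y ^ q ^ (s + 1)).natDegree
        = (c (s + 1)).natDegree + q ^ (s + 1) * y.natDegree := by
      rw [natDegree_mul hcr (pow_ne_zero _ hy0), natDegree_pow]
    have hsmall : (X * y + ∑ i ∈ Finset.range s, c (i + 1) * y ^ q ^ (i + 1)).natDegree
        ≤ m + (c (s + 1)).natDegree + q ^ s * y.natDegree := by
      apply natDegree_add_le_of_degree_le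
      · refine natDegree_mul_le.trans ?_
        have : y.natDegree ≤ q ^ s * y.natDegree :=
          Nat.le_mul_of_pos_left _ (by positivity)
        rw [natDegree_X]
        omega
      · apply natDegree_sum_le_of_forall_le
        intro i hi
        have hi' := Finset.mem_range.mp hi
        refine natDegree_mul_le.trans ?_
        rw [natDegree_pow]
        refine Nat.add_le_add (hmi' i hi') (Nat.mul_le_mul_right _ ?_)
        exact Nat.pow_le_pow_right (by omega) (by omega)
    rw [hφ, Finset.sum_range_succ, ← add_assoc, ← hlead]
    apply natDegree_add_eq_right_of_natDegree_lt
    rw [hlead]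
    omega
  have hqR : (2 : ℝ) ≤ q := by exact_mod_cast hq2
  have hΘ2 : (2 : ℝ) ≤ Θ := by
    rw [hΘ]
    have : q ^ 1 ≤ q ^ (s + 1) := Nat.pow_le_pow_right (by omega) (by omega)
    rw [pow_one] at this
    exact_mod_cast hq2.trans this
  have hmR : (0 : ℝ) ≤ m := Nat.cast_nonneg m
  have hden : 0 < ((Θ : ℝ) - 1) * ((q : ℝ) - 1) := mul_pos (by linarith) (by linarith)
  by_cases hx : m + q ^ s * x.natDegree < q ^ (s + 1) * x.natDegree
  · have hiter : ∀ n, Θ ^ n * x.natDegree ≤ (φ^[n] x).natDegree := by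
      intro n
      induction n with
      | zero => simp
      | succ n ih =>
        rw [Function.iterate_succ_apply']
        have hge : x.natDegree ≤ (φ^[n] x).natDegree :=
          (Nat.le_mul_of_pos_left _ (by rw [hΘ]; positivity)).trans ih
        have hlt : m + q ^ s * (φ^[n] x).natDegree < q ^ (s + 1) * (φ^[n] x).natDegree := by
          obtain ⟨k, hk⟩ := Nat.exists_eq_add_of_le hge
          rw [hk, mul_add, mul_add]
          have : q ^ s * k ≤ q ^ (s + 1) * k :=
            Nat.mul_le_mul_right _ (Nat.pow_le_pow_right (by omega) (by omega))
          omega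
        rw [hstep _ hlt, ← hΘ, pow_succ']
        have := Nat.mul_le_mul_left Θ ih
        rw [mul_assoc]
        omega
    have hLge : (x.natDegree : ℝ) ≤ L := by
      refine ge_of_tendsto' hL fun n => ?_
      rw [le_div_iff₀ (by positivity), mul_comm]
      exact_mod_cast hiter n
    have hMnn : 0 ≤ Mφ := by
      rw [hM]
      exact mul_nonneg (div_nonneg (by linarith) hden.le) hmR
    linarith
  · have hL0 : 0 ≤ L := ge_of_tendsto' hL fun n => by positivity
    have h1 : (q : ℝ) ^ (s + 1) * x.natDegree ≤ m + (q : ℝ) ^ s * x.natDegree := by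
      exact_mod_cast not_lt.mp hx
    have hxM : (x.natDegree : ℝ) ≤ Mφ := by
      rw [hM, div_mul_eq_mul_div, le_div_iff₀ hden]
      have hΘR : (Θ : ℝ) = q * (q : ℝ) ^ s := by rw [hΘ]; push_cast; ring
      have h2 : (Θ : ℝ) * (q - 1) * x.natDegree ≤ q * m := by
        have := mul_le_mul_of_nonneg_left h1 (by linarith : (0 : ℝ) ≤ q)
        rw [hΘR]
        rw [pow_succ] at this
        linarith
      have h3 : (0 : ℝ) ≤ (q - 1) * x.natDegree :=
        mul_nonneg (by linarith) (Nat.cast_nonneg _)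
      linarith
    linarith
end

section
/- Let φ_T(x) = T·x + c_1·x^q + ⋯ + c_r·x^{q^r} with c_1, …, c_r ∈ 𝔽_q[T], c_r ≠ 0, and set Θ = q^r and M′_φ = (1/(Θ − 1))·max{1, deg c_1, …, deg c_r}. Let x ∈ 𝔽_q[T] and suppose that the sequence n ↦ h(φ_{T^n}(x))/Θ^n converges to a real number L (the canonical height ĥ(x)). Then L − h(x) ≤ M′_φ. -/
open Polynomial Filter

/-- If the canonical height `ĥ(x) = lim h(φ_{T^n}(x))/Θ^n` of `x ∈ 𝔽_q[T]` exists and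
equals `L`, then `ĥ(x) − h(x) ≤ M′_φ`, where
`M′_φ = (1/(Θ − 1))·max{1, deg c_1, …, deg c_r}`. -/
theorem canonical_sub_classical_le
    {Fq : Type*} [Field Fq] [Fintype Fq]
    (q : ℕ) (hq : q = Fintype.card Fq)
    (r : ℕ) (hr : 1 ≤ r) (c : ℕ → Polynomial Fq) (hcr : c r ≠ 0)
    (φ : Polynomial Fq → Polynomial Fq)
    (hφ : ∀ y, φ y = Polynomial.X * y + ∑ i ∈ Finset.range r, c (i + 1) * y ^ q ^ (i + 1))
    (Θ : ℕ) (hΘ : Θ = q ^ r)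
    (M'φ : ℝ)
    (hM' : M'φ = (1 / ((Θ : ℝ) - 1))
      * ((((Finset.range (r + 1)).sup fun i => if i = 0 then 1 else (c i).natDegree : ℕ) : ℝ)))
    (x : Polynomial Fq) (L : ℝ)
    (hL : Tendsto (fun n => ((φ^[n] x).natDegree : ℝ) / (Θ : ℝ) ^ n) atTop (nhds L)) :
    L - (x.natDegree : ℝ) ≤ M'φ := by
  have hq2 : 2 ≤ q := by rw [hq]; exact Fintype.one_lt_card
  have hΘ2 : 2 ≤ Θ := by
    rw [hΘ]
    calc 2 ≤ q := hq2
      _ = q ^ 1 := (pow_one q).symm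
      _ ≤ q ^ r := Nat.pow_le_pow_right (by omega) hr
  set D : ℕ := (Finset.range (r + 1)).sup fun i => if i = 0 then 1 else (c i).natDegree with hD
  have hD1 : 1 ≤ D := by
    have := Finset.le_sup (f := fun i => if i = 0 then 1 else (c i).natDegree)
      (Finset.mem_range.mpr (Nat.succ_pos r))
    exact this
  have hDc : ∀ i < r, (c (i + 1)).natDegree ≤ D := by
    intro i hi
    have := Finset.le_sup (f := fun i => if i = 0 then 1 else (c i).natDegree)
      (Finset.mem_range.mpr (Nat.succ_lt_succ hi))
    simpa using this
  have hstep : ∀ y, (φ y).natDegree ≤ Θ * y.natDegree + D := by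
    intro y
    rw [hφ]
    apply natDegree_add_le_of_degree_le
    · refine natDegree_mul_le.trans ?_
      have h1 : (X : Polynomial Fq).natDegree ≤ 1 := natDegree_X_le
      nlinarith [Nat.zero_le y.natDegree]
    · apply natDegree_sum_le_of_forall_le
      intro i hi
      have hi' := Finset.mem_range.mp hi
      refine natDegree_mul_le.trans ?_
      have h1 := hDc i hi'
      have h2 : (y ^ q ^ (i + 1)).natDegree ≤ q ^ (i + 1) * y.natDegree := natDegree_pow_le
      have h3 : q ^ (i + 1) * y.natDegree ≤ Θ * y.natDegree := by
        rw [hΘ]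
        exact Nat.mul_le_mul_right _ (Nat.pow_le_pow_right (by omega) hi')
      omega
  have hΘR : (2 : ℝ) ≤ Θ := by exact_mod_cast hΘ2
  have hne : (Θ : ℝ) - 1 ≠ 0 := by linarith
  have hKD : M'φ * ((Θ : ℝ) - 1) = D := by
    rw [hM']; field_simp
  have hK0 : 0 ≤ M'φ := by
    rw [hM']
    have : (0 : ℝ) ≤ (Θ : ℝ) - 1 := by linarith
    positivity
  have hind : ∀ n, ((φ^[n] x).natDegree : ℝ) + M'φ ≤ (Θ : ℝ) ^ n * (x.natDegree + M'φ) := by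
    intro n
    induction n with
    | zero => simp
    | succ n ih =>
      rw [Function.iterate_succ_apply']
      have h1 : ((φ (φ^[n] x)).natDegree : ℝ) ≤ Θ * (φ^[n] x).natDegree + D := by
        exact_mod_cast hstep (φ^[n] x)
      have h2 := mul_le_mul_of_nonneg_left ih (by linarith : (0 : ℝ) ≤ Θ)
      rw [pow_succ]
      linarith
  have hle : L ≤ x.natDegree + M'φ := by
    refine le_of_tendsto' hL fun n => ?_
    have hp : (0 : ℝ) < (Θ : ℝ) ^ n := by positivity
    rw [div_le_iff₀ hp]
    linarith [hind n]
  linarith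
end

section
/- Let g, Δ ∈ 𝔽_q[T] with Δ ≠ 0 and let φ_T(x) = T·x + g·x^q + Δ·x^{q²}. Let x ∈ 𝔽_q[T] and suppose that the sequence n ↦ h(φ_{T^n}(x))/q^{2n} converges to a real number L (the canonical height ĥ(x)). Then h(x) − L ≤ (1 + deg g)/(q − 1)². -/
open Polynomial Filter

theorem step_aux {F : Type*} [Field F] (r : ℕ) (g Δ y : Polynomial F) (hΔ : Δ ≠ 0)
    (h : 1 + g.natDegree < r ^ 2 * y.natDegree) :
    (r + 1) ^ 2 * y.natDegree ≤
      (Polynomial.X * y + g * y ^ (r + 1) + Δ * y ^ (r + 1) ^ 2).natDegree := by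
  have hy : y ≠ 0 := by
    rintro rfl
    simp at h
  have h3 : (Δ * y ^ (r + 1) ^ 2).natDegree = Δ.natDegree + (r + 1) ^ 2 * y.natDegree := by
    rw [natDegree_mul hΔ (pow_ne_zero _ hy), natDegree_pow]
  have h1 : (Polynomial.X * y).natDegree ≤ 1 + y.natDegree :=
    natDegree_mul_le.trans (by simp)
  have h2 : (g * y ^ (r + 1)).natDegree ≤ g.natDegree + (r + 1) * y.natDegree :=
    natDegree_mul_le.trans (by rw [natDegree_pow])
  have e : (r + 1) ^ 2 * y.natDegree
      = r ^ 2 * y.natDegree + 2 * (r * y.natDegree) + y.natDegree := by ring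
  have e2 : (r + 1) * y.natDegree = r * y.natDegree + y.natDegree := by ring
  have h12 := natDegree_add_le (Polynomial.X * y) (g * y ^ (r + 1))
  rw [natDegree_add_eq_right_of_natDegree_lt]
  · omega
  · refine lt_of_le_of_lt h12 (max_lt ?_ ?_) <;> omega

theorem iter_aux {F : Type*} [Field F] (r : ℕ) (g Δ : Polynomial F) (hΔ : Δ ≠ 0)
    (φ : Polynomial F → Polynomial F)
    (hφ : ∀ y, φ y = Polynomial.X * y + g * y ^ (r + 1) + Δ * y ^ (r + 1) ^ 2)
    (x : Polynomial F) (h : 1 + g.natDegree < r ^ 2 * x.natDegree) (n : ℕ) :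
    (r + 1) ^ (2 * n) * x.natDegree ≤ (φ^[n] x).natDegree := by
  induction n with
  | zero => simp
  | succ n ih =>
    rw [Function.iterate_succ_apply', hφ]
    have hle : x.natDegree ≤ (φ^[n] x).natDegree :=
      le_trans (Nat.le_mul_of_pos_left _ (by positivity)) ih
    refine le_trans ?_ (step_aux r g Δ _ hΔ (lt_of_lt_of_le h (Nat.mul_le_mul_left _ hle)))
    calc (r + 1) ^ (2 * (n + 1)) * x.natDegree
        = (r + 1) ^ 2 * ((r + 1) ^ (2 * n) * x.natDegree) := by ring
      _ ≤ _ := Nat.mul_le_mul_left _ ih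

/-- For the rank 2 Drinfeld module `φ_T(x) = T·x + g·x^q + Δ·x^{q²}` and `x ∈ 𝔽_q[T]`:
if the canonical height `ĥ(x) = lim h(φ_{T^n}(x))/q^{2n}` exists and equals `L`, then
`h(x) − ĥ(x) ≤ (1 + deg g)/(q − 1)²`. -/
theorem classical_sub_canonical_le_rank_two
    {Fq : Type*} [Field Fq] [Fintype Fq]
    (q : ℕ) (hq : q = Fintype.card Fq)
    (g Δ : Polynomial Fq) (hΔ : Δ ≠ 0)
    (φ : Polynomial Fq → Polynomial Fq)
    (hφ : ∀ y, φ y = Polynomial.X * y + g * y ^ q + Δ * y ^ q ^ 2)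
    (x : Polynomial Fq) (L : ℝ)
    (hL : Tendsto (fun n => ((φ^[n] x).natDegree : ℝ) / (q : ℝ) ^ (2 * n)) atTop (nhds L)) :
    (x.natDegree : ℝ) - L ≤ (1 + (g.natDegree : ℝ)) / ((q : ℝ) - 1) ^ 2 := by
  have hq2 : 1 < q := hq ▸ Fintype.one_lt_card
  obtain ⟨r, rfl⟩ : ∃ r, q = r + 1 := ⟨q - 1, by omega⟩
  have hr : 0 < r := by omega
  have hr' : (0 : ℝ) < r := by exact_mod_cast hr
  have hqr : (((r + 1 : ℕ) : ℝ) - 1) = r := by push_cast; ring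
  rw [hqr]
  by_cases h : 1 + g.natDegree < r ^ 2 * x.natDegree
  · have hge : (x.natDegree : ℝ) ≤ L := by
      refine ge_of_tendsto' hL fun n => ?_
      rw [le_div_iff₀ (by positivity), mul_comm]
      exact_mod_cast iter_aux r g Δ hΔ φ hφ x h n
    have : (0 : ℝ) ≤ (1 + (g.natDegree : ℝ)) / (r : ℝ) ^ 2 := by positivity
    linarith
  · have hL0 : 0 ≤ L := ge_of_tendsto' hL fun n => by positivity
    have h' : (r : ℝ) ^ 2 * x.natDegree ≤ 1 + g.natDegree := by exact_mod_cast not_lt.mp h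
    have : (x.natDegree : ℝ) ≤ (1 + (g.natDegree : ℝ)) / (r : ℝ) ^ 2 := by
      rw [le_div_iff₀ (by positivity), mul_comm]
      exact h'
    linarith
end

section
/- Let g, Δ ∈ 𝔽_q[T] with Δ ≠ 0 and let φ_T(x) = T·x + g·x^q + Δ·x^{q²}. Let x ∈ 𝔽_q[T] and suppose that the sequence n ↦ h(φ_{T^n}(x))/q^{2n} converges to a real number L (the canonical height ĥ(x)). Then L − h(x) ≤ (deg Δ + deg g + 1)/(q − 1)². -/
open Polynomial Filter

/-- For the rank 2 Drinfeld module `φ_T(x) = T·x + g·x^q + Δ·x^{q²}` and `x ∈ 𝔽_q[T]`: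
if the canonical height `ĥ(x) = lim h(φ_{T^n}(x))/q^{2n}` exists and equals `L`, then
`ĥ(x) − h(x) ≤ (deg Δ + deg g + 1)/(q − 1)²`. -/
theorem canonical_sub_classical_le_rank_two
    {Fq : Type*} [Field Fq] [Fintype Fq]
    (q : ℕ) (hq : q = Fintype.card Fq)
    (g Δ : Polynomial Fq) (hΔ : Δ ≠ 0)
    (φ : Polynomial Fq → Polynomial Fq)
    (hφ : ∀ y, φ y = Polynomial.X * y + g * y ^ q + Δ * y ^ q ^ 2)
    (x : Polynomial Fq) (L : ℝ)
    (hL : Tendsto (fun n => ((φ^[n] x).natDegree : ℝ) / (q : ℝ) ^ (2 * n)) atTop (nhds L)) :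
    L - (x.natDegree : ℝ) ≤ ((Δ.natDegree : ℝ) + (g.natDegree : ℝ) + 1) / ((q : ℝ) - 1) ^ 2 := by
  have hq2 : 2 ≤ q := by
    rw [hq]; exact Fintype.one_lt_card
  have hqR : (2 : ℝ) ≤ q := by exact_mod_cast hq2
  have step : ∀ y, (φ y).natDegree ≤
      q ^ 2 * y.natDegree + (Δ.natDegree + g.natDegree + 1) := by
    intro y
    have hqq : q ≤ q ^ 2 := by nlinarith
    have h1 : (Polynomial.X * y).natDegree ≤ 1 + y.natDegree :=
      natDegree_mul_le.trans (by rw [natDegree_X])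
    have h2 : (g * y ^ q).natDegree ≤ g.natDegree + q * y.natDegree :=
      natDegree_mul_le.trans (Nat.add_le_add_left natDegree_pow_le _)
    have h3 : (Δ * y ^ q ^ 2).natDegree ≤ Δ.natDegree + q ^ 2 * y.natDegree :=
      natDegree_mul_le.trans (Nat.add_le_add_left natDegree_pow_le _)
    have h4 : q * y.natDegree ≤ q ^ 2 * y.natDegree := Nat.mul_le_mul_right _ hqq
    have h5 : 1 * y.natDegree ≤ q ^ 2 * y.natDegree :=
      Nat.mul_le_mul_right _ (by omega)
    rw [hφ]
    refine (natDegree_add_le _ _).trans (max_le ((natDegree_add_le _ _).trans (max_le ?_ ?_)) ?_)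
      <;> omega
  set C : ℝ := (Δ.natDegree : ℝ) + (g.natDegree : ℝ) + 1 with hC
  have hC0 : 0 ≤ C := by positivity
  have hpos : 0 < ((q : ℝ) - 1) ^ 2 := by
    have : 0 < (q : ℝ) - 1 := by linarith
    positivity
  set K : ℝ := C / ((q : ℝ) - 1) ^ 2 with hK
  have hK0 : 0 ≤ K := by positivity
  have hKC : K * ((q : ℝ) - 1) ^ 2 = C := div_mul_cancel₀ _ hpos.ne'
  have hKq : C + K ≤ (q : ℝ) ^ 2 * K := by nlinarith
  have main : ∀ n, ((φ^[n] x).natDegree : ℝ) + K ≤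
      (q : ℝ) ^ (2 * n) * ((x.natDegree : ℝ) + K) := by
    intro n
    induction n with
    | zero => simp
    | succ n ih =>
      rw [Function.iterate_succ_apply']
      have hs : ((φ (φ^[n] x)).natDegree : ℝ) ≤
          (q : ℝ) ^ 2 * ((φ^[n] x).natDegree : ℝ) + C := by
        rw [hC]; exact_mod_cast step (φ^[n] x)
      have hm := mul_le_mul_of_nonneg_left ih (sq_nonneg (q : ℝ))
      have he : (q : ℝ) ^ (2 * (n + 1)) = (q : ℝ) ^ 2 * (q : ℝ) ^ (2 * n) := by ring
      rw [he, mul_assoc]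
      linarith
  have hle : L ≤ (x.natDegree : ℝ) + K := by
    refine le_of_tendsto' hL (fun n => ?_)
    rw [div_le_iff₀ (by positivity)]
    linarith [main n]
  linarith
end

section
/- Let g, Δ ∈ 𝔽_q[T] with Δ ≠ 0, let φ_T(x) = T·x + g·x^q + Δ·x^{q²}, and let x ∈ 𝔽_q[T]. Let P ∈ 𝔽_q[T] be a monic irreducible polynomial with P ≠ T. If m ≥ 0, φ_{T^m}(x) ≠ 0 and P divides φ_{T^m}(x), then ord_P(φ_{T^{m+1}}(x)) = ord_P(φ_{T^m}(x)) (in particular φ_{T^{m+1}}(x) ≠ 0). Consequently, if the rank of apparition r_P = min{n ≥ 1 : P ∣ φ_{T^n}(x)} is attained and φ_{T^{r_P}}(x) ≠ 0, then ord_P(φ_{T^ℓ}(x)) = ord_P(φ_{T^{r_P}}(x)) for every ℓ ≥ r_P. -/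
open Polynomial UniqueFactorizationMonoid

/-- Let `φ_T(y) = T·y + g·y^q + Δ·y^{q²}` and let `P ≠ T` be monic irreducible.
If `φ_{T^m}(x) ≠ 0` and `P ∣ φ_{T^m}(x)`, then `φ_{T^{m+1}}(x) ≠ 0` and
`ord_P(φ_{T^{m+1}}(x)) = ord_P(φ_{T^m}(x))`. Consequently, if the rank of apparition
`r_P = min{n ≥ 1 : P ∣ φ_{T^n}(x)}` is attained and `φ_{T^{r_P}}(x) ≠ 0`, then
`ord_P(φ_{T^ℓ}(x)) = ord_P(φ_{T^{r_P}}(x))` for every `ℓ ≥ r_P`. -/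
theorem rank_of_apparition
    {Fq : Type*} [Field Fq] [Fintype Fq] [DecidableEq Fq]
    (q : ℕ) (hq : q = Fintype.card Fq)
    (g Δ : Polynomial Fq) (hΔ : Δ ≠ 0)
    (φ : Polynomial Fq → Polynomial Fq)
    (hφ : ∀ y, φ y = Polynomial.X * y + g * y ^ q + Δ * y ^ q ^ 2)
    (x : Polynomial Fq)
    (P : Polynomial Fq) (hPm : P.Monic) (hPi : Irreducible P) (hPT : P ≠ Polynomial.X) :
    (∀ m : ℕ, φ^[m] x ≠ 0 → P ∣ φ^[m] x →
      φ^[m + 1] x ≠ 0 ∧ ordP P (φ^[m + 1] x) = ordP P (φ^[m] x)) ∧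
    ((∃ n, 1 ≤ n ∧ P ∣ φ^[n] x) →
      φ^[sInf {n | 1 ≤ n ∧ P ∣ φ^[n] x}] x ≠ 0 →
      ∀ ℓ, sInf {n | 1 ≤ n ∧ P ∣ φ^[n] x} ≤ ℓ →
        ordP P (φ^[ℓ] x) = ordP P (φ^[sInf {n | 1 ≤ n ∧ P ∣ φ^[n] x}] x)) := by
  have hq2 : 2 ≤ q := by
    rw [hq]; exact Fintype.one_lt_card
  obtain ⟨k, rfl⟩ : ∃ k, q = k + 2 := ⟨q - 2, by omega⟩
  obtain ⟨j, hj⟩ : ∃ j, (k + 2) ^ 2 = j + 2 := ⟨k ^ 2 + 4 * k + 2, by ring⟩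
  have hfac : ∀ y, φ y = y * (X + y * (g * y ^ k + Δ * y ^ j)) := by
    intro y
    rw [hφ, hj]
    ring
  have hPX : ¬ P ∣ X := by
    intro h
    have hass : Associated P (X : Polynomial Fq) :=
      (hPi.dvd_irreducible_iff_associated Polynomial.irreducible_X).1 h
    exact hPT (Polynomial.eq_of_monic_of_associated hPm Polynomial.monic_X hass)
  have key : ∀ y : Polynomial Fq, y ≠ 0 → P ∣ y →
      φ y ≠ 0 ∧ ordP P (φ y) = ordP P y := by
    intro y hy hd
    have hu : ¬ P ∣ (X + y * (g * y ^ k + Δ * y ^ j)) := by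
      intro h
      exact hPX ((dvd_add_left (hd.mul_right _)).1 h)
    have hu0 : (X + y * (g * y ^ k + Δ * y ^ j)) ≠ 0 := by
      intro h
      exact hu (h ▸ dvd_zero P)
    rw [hfac]
    refine ⟨mul_ne_zero hy hu0, ?_⟩
    unfold ordP
    rw [Subsingleton.elim (Classical.decEq (Polynomial Fq)) (fun a b => inferInstance)]
    rw [normalizedFactors_mul hy hu0, Multiset.count_add, Nat.add_eq_left]
    exact Multiset.count_eq_zero_of_notMem fun h => hu (dvd_of_mem_normalizedFactors h)
  refine ⟨fun m h0 hd => ?_, fun hex h0 ℓ hℓ => ?_⟩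
  · rw [Function.iterate_succ_apply']
    exact key _ h0 hd
  · have hmem : P ∣ φ^[sInf {n | 1 ≤ n ∧ P ∣ φ^[n] x}] x := (Nat.sInf_mem hex).2
    generalize sInf {n | 1 ≤ n ∧ P ∣ φ^[n] x} = r at h0 hℓ hmem ⊢
    have main : φ^[ℓ] x ≠ 0 ∧ P ∣ φ^[ℓ] x ∧ ordP P (φ^[ℓ] x) = ordP P (φ^[r] x) := by
      induction ℓ, hℓ using Nat.le_induction with
      | base => exact ⟨h0, hmem, rfl⟩
      | succ n hn ih =>
        obtain ⟨h1, h2, h3⟩ := ih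
        rw [Function.iterate_succ_apply']
        obtain ⟨h4, h5⟩ := key _ h1 h2
        refine ⟨h4, ?_, h5.trans h3⟩
        rw [hfac]
        exact h2.mul_right _
    exact main.2.2
end

section
/- Let g, Δ ∈ 𝔽_q[T] with Δ ≠ 0 and let φ_T(x) = T·x + g·x^q + Δ·x^{q²}. Assume every monic irreducible factor of Δ has degree 1 and that φ_T(1) = T + g + Δ is coprime to TΔ in 𝔽_q[T]. Then for every x ∈ 𝔽_q[T] coprime to TΔ and every n ≥ 1, the polynomial φ_{T^n}(x) is coprime to TΔ (in particular φ_{T^n}(x) ≠ 0); equivalently, the sum over the places v of S of log_q max{|φ_{T^n}(x)^{−1}|_v, 1} is equal to 0. -/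
open Polynomial UniqueFactorizationMonoid

theorem step_coprime_aux
    {Fq : Type*} [Field Fq] [Fintype Fq] [DecidableEq Fq]
    (g Δ y : Polynomial Fq) (hΔ : Δ ≠ 0)
    (hsplit : ∀ P : Polynomial Fq, P.Monic → Irreducible P → P ∣ Δ → P.natDegree = 1)
    (hcop : IsCoprime (Polynomial.X + g + Δ) (Polynomial.X * Δ))
    (hy : IsCoprime y (Polynomial.X * Δ)) :
    IsCoprime (Polynomial.X * y + g * y ^ (Fintype.card Fq) + Δ * y ^ (Fintype.card Fq) ^ 2)
      (Polynomial.X * Δ) := by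
  have key : ∀ (f : Polynomial Fq) (a : Fq), IsCoprime f (Polynomial.X * Δ) →
      (Polynomial.X * Δ).eval a = 0 → f.eval a ≠ 0 := by
    rintro f a ⟨u, v, h⟩ h0 h1
    have h2 := congrArg (Polynomial.eval a) h
    rw [eval_add, eval_mul, eval_mul (p := v), h0, h1] at h2
    simp at h2
  apply isCoprime_of_irreducible_dvd
  · rintro ⟨-, h⟩
    exact mul_ne_zero X_ne_zero hΔ h
  · intro z hz h1 h2
    have hdeg : z.degree = 1 := by
      rcases hz.prime.dvd_or_dvd h2 with h | h
      · have := hz.associated_of_dvd irreducible_X h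
        rw [degree_eq_degree_of_associated this, degree_X]
      · have h3 := hsplit (normalize z) (monic_normalize hz.ne_zero)
          ((normalize_associated z).symm.irreducible hz) ((normalize_associated z).dvd.trans h)
        rw [← degree_normalize, degree_eq_natDegree
          (by simpa using hz.ne_zero), h3]
        rfl
    obtain ⟨a, ha⟩ := exists_root_of_degree_eq_one hdeg
    have e1 := key _ a hcop (ha.dvd h2)
    have e2 := key _ a hy (ha.dvd h2)
    have e3 := ha.dvd h1
    apply mul_ne_zero e2 e1
    have e4 : eval a y ^ (Fintype.card Fq) = eval a y := FiniteField.pow_card _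
    have e5 : eval a y ^ (Fintype.card Fq) ^ 2 = eval a y := FiniteField.pow_card_pow 2 _
    simp only [IsRoot, eval_add, eval_mul, eval_pow, eval_X, e4, e5] at e3 ⊢
    linear_combination e3

/-- Let `φ_T(y) = T·y + g·y^q + Δ·y^{q²}`, where every monic irreducible factor of `Δ`
has degree `1` and `φ_T(1) = T + g + Δ` is coprime to `TΔ`. Then for every `x ∈ 𝔽_q[T]`
coprime to `TΔ` and every `n ≥ 1`, the polynomial `φ_{T^n}(x)` is coprime to `TΔ`
(in particular nonzero); equivalently the sum over the places `v ∈ S` of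
`log_q max{|φ_{T^n}(x)^{−1}|_v, 1}` vanishes, i.e.
`Σ_{P ∣ TΔ} deg P · ord_P(φ_{T^n}(x)) + max(0, −deg φ_{T^n}(x)) = 0`. -/
theorem orbit_coprime_local_heights_vanish
    {Fq : Type*} [Field Fq] [Fintype Fq] [DecidableEq Fq]
    (q : ℕ) (hq : q = Fintype.card Fq)
    (g Δ : Polynomial Fq) (hΔ : Δ ≠ 0)
    (φ : Polynomial Fq → Polynomial Fq)
    (hφ : ∀ y, φ y = Polynomial.X * y + g * y ^ q + Δ * y ^ q ^ 2)
    (hsplit : ∀ P : Polynomial Fq, P.Monic → Irreducible P → P ∣ Δ → P.natDegree = 1)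
    (hcop : IsCoprime (Polynomial.X + g + Δ) (Polynomial.X * Δ))
    (x : Polynomial Fq) (hx : IsCoprime x (Polynomial.X * Δ))
    (n : ℕ) (hn : 1 ≤ n) :
    IsCoprime (φ^[n] x) (Polynomial.X * Δ) ∧ φ^[n] x ≠ 0 ∧
      (∑ᶠ P ∈ {P : Polynomial Fq | P.Monic ∧ Irreducible P ∧ P ∣ Polynomial.X * Δ},
          (P.natDegree : ℝ) * (ordP P (φ^[n] x) : ℝ))
        + max 0 (-((φ^[n] x).natDegree : ℝ)) = 0 := by
  subst hq
  have hc : ∀ m, IsCoprime (φ^[m] x) (Polynomial.X * Δ) := by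
    intro m
    induction m with
    | zero => simpa using hx
    | succ k ih =>
      rw [Function.iterate_succ_apply', hφ]
      exact step_coprime_aux g Δ _ hΔ hsplit hcop ih
  have h1 := hc n
  have hnd : ∀ P : Polynomial Fq, Irreducible P → P ∣ Polynomial.X * Δ → ¬ P ∣ φ^[n] x :=
    fun P hP h2 h3 => hP.not_isUnit (h1.isUnit_of_dvd' h3 h2)
  refine ⟨h1, ?_, ?_⟩
  · intro h
    exact hnd X irreducible_X (dvd_mul_right _ _) (h ▸ dvd_zero _)
  · rw [max_eq_left (by simp), add_zero]
    apply finsum_mem_eq_zero_of_forall_eq_zero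
    rintro P ⟨-, hP, h2⟩
    have : ordP P (φ^[n] x) = 0 := by
      unfold ordP
      refine @Multiset.count_eq_zero_of_notMem _ (Classical.decEq _) _ _ ?_
      exact fun h => hnd P hP h2 (dvd_of_mem_normalizedFactors h)
    rw [this]
    simp
end

section
/- Let g, Δ ∈ 𝔽_q[T] with Δ ≠ 0, let φ_T(x) = T·x + g·x^q + Δ·x^{q²}, set Θ = q² and M′_φ = (1/(q² − 1))·max{1, deg g, deg Δ}. Let x ∈ 𝔽_q[T] and suppose the sequence m ↦ h(φ_{T^m}(x))/Θ^m converges to a real number L (the canonical height ĥ(x)). Then for every n ≥ 0 with 𝔄_n := φ_{T^n}(x) ≠ 0, one has L − (1/Θ^n)·Σ_{P monic irreducible, P ∤ TΔ} deg P · ord_P(𝔄_n) ≤ M′_φ/Θ^n + (1/Θ^n)·Σ_{P monic irreducible, P ∣ TΔ} deg P · ord_P(𝔄_n). (The first sum is log_q Nr^S(𝔄_n) and the second is Σ_{v ∈ S} log_q max{|φ_{T^n}(x)^{−1}|_v, 1}, the infinite-place contribution being zero for a nonzero polynomial.) -/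
open Polynomial UniqueFactorizationMonoid Filter

theorem sum_aux {Fq : Type*} [Field Fq] [DecidableEq Fq] (f D : Polynomial Fq) (hf : f ≠ 0) :
    (∑ᶠ P ∈ {P : Polynomial Fq | P.Monic ∧ Irreducible P ∧ ¬ P ∣ D},
            (P.natDegree : ℝ) * (ordP P f : ℝ)) +
    (∑ᶠ P ∈ {P : Polynomial Fq | P.Monic ∧ Irreducible P ∧ P ∣ D},
            (P.natDegree : ℝ) * (ordP P f : ℝ)) = (f.natDegree : ℝ) := by
  classical
  have hord : ∀ P, ordP P f = (normalizedFactors f).count P := by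
    intro P
    unfold ordP
    congr!
  have hmem : ∀ P ∈ normalizedFactors f, P.Monic ∧ Irreducible P := by
    intro P hP
    have h1 := irreducible_of_normalized_factor P hP
    refine ⟨?_, h1⟩
    have h2 := normalize_normalized_factor P hP
    rw [← h2]
    exact Polynomial.monic_normalize h1.ne_zero
  have hs : ∀ P, (P.natDegree : ℝ) * (ordP P f : ℝ) ≠ 0 → P ∈ (normalizedFactors f).toFinset := by
    intro P h
    rw [Multiset.mem_toFinset]
    by_contra hc
    apply h
    rw [hord, Multiset.count_eq_zero_of_notMem hc]
    simp
  have e1 := finsum_mem_eq_sum_of_inter_support_eq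
    (fun P : Polynomial Fq => (P.natDegree : ℝ) * (ordP P f : ℝ))
    (s := {P : Polynomial Fq | P.Monic ∧ Irreducible P ∧ ¬ P ∣ D})
    (t := (normalizedFactors f).toFinset.filter (fun P => ¬ P ∣ D)) (by
      ext P
      simp only [Set.mem_inter_iff, Set.mem_setOf_eq, Function.mem_support, Finset.coe_filter]
      constructor
      · rintro ⟨⟨_, _, h⟩, h'⟩
        exact ⟨⟨hs P h', h⟩, h'⟩
      · rintro ⟨⟨h1, h⟩, h'⟩
        obtain ⟨a, b⟩ := hmem P (Multiset.mem_toFinset.1 h1)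
        exact ⟨⟨a, b, h⟩, h'⟩)
  have e2 := finsum_mem_eq_sum_of_inter_support_eq
    (fun P : Polynomial Fq => (P.natDegree : ℝ) * (ordP P f : ℝ))
    (s := {P : Polynomial Fq | P.Monic ∧ Irreducible P ∧ P ∣ D})
    (t := (normalizedFactors f).toFinset.filter (fun P => P ∣ D)) (by
      ext P
      simp only [Set.mem_inter_iff, Set.mem_setOf_eq, Function.mem_support, Finset.coe_filter]
      constructor
      · rintro ⟨⟨_, _, h⟩, h'⟩
        exact ⟨⟨hs P h', h⟩, h'⟩
      · rintro ⟨⟨h1, h⟩, h'⟩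
        obtain ⟨a, b⟩ := hmem P (Multiset.mem_toFinset.1 h1)
        exact ⟨⟨a, b, h⟩, h'⟩)
  rw [e1, e2, add_comm, Finset.sum_filter_add_sum_filter_not]
  have hd : f.natDegree = ((normalizedFactors f).map natDegree).sum := by
    rw [← Polynomial.natDegree_multiset_prod _ (zero_notMem_normalizedFactors f)]
    exact (Polynomial.natDegree_eq_of_degree_eq
      (Polynomial.degree_eq_degree_of_associated (prod_normalizedFactors hf))).symm
  rw [hd, Finset.sum_multiset_map_count]
  push_cast
  refine Finset.sum_congr rfl fun P _ => ?_
  rw [hord]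
  simp [mul_comm]

/-- Let `φ_T(y) = T·y + g·y^q + Δ·y^{q²}`, `Θ = q²`,
`M′_φ = (1/(q² − 1))·max{1, deg g, deg Δ}`, and suppose the canonical height
`ĥ(x) = lim h(φ_{T^m}(x))/Θ^m` of `x ∈ 𝔽_q[T]` exists and equals `L`. Then for every
`n` with `𝔄_n = φ_{T^n}(x) ≠ 0`:
`L − (1/Θ^n)·log_q Nr^S(𝔄_n) ≤ M′_φ/Θ^n + (1/Θ^n)·Σ_{v ∈ S} log_q max{|𝔄_n^{−1}|_v, 1}`,
where `log_q Nr^S(𝔄_n) = Σ_{P ∤ TΔ} deg P · ord_P(𝔄_n)` and the right-hand sum is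
`Σ_{P ∣ TΔ} deg P · ord_P(𝔄_n)`. -/
theorem canonical_height_vs_prime_to_S_norm
    {Fq : Type*} [Field Fq] [Fintype Fq] [DecidableEq Fq]
    (q : ℕ) (hq : q = Fintype.card Fq)
    (g Δ : Polynomial Fq) (hΔ : Δ ≠ 0)
    (φ : Polynomial Fq → Polynomial Fq)
    (hφ : ∀ y, φ y = Polynomial.X * y + g * y ^ q + Δ * y ^ q ^ 2)
    (Θ : ℕ) (hΘ : Θ = q ^ 2)
    (M'φ : ℝ)
    (hM' : M'φ = (1 / ((q : ℝ) ^ 2 - 1)) * ((max 1 (max g.natDegree Δ.natDegree) : ℕ) : ℝ))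
    (x : Polynomial Fq) (L : ℝ)
    (hL : Tendsto (fun m => ((φ^[m] x).natDegree : ℝ) / (Θ : ℝ) ^ m) atTop (nhds L))
    (n : ℕ) (hne : φ^[n] x ≠ 0) :
    L - (1 / (Θ : ℝ) ^ n)
        * (∑ᶠ P ∈ {P : Polynomial Fq | P.Monic ∧ Irreducible P ∧ ¬ P ∣ Polynomial.X * Δ},
            (P.natDegree : ℝ) * (ordP P (φ^[n] x) : ℝ))
      ≤ M'φ / (Θ : ℝ) ^ n
        + (1 / (Θ : ℝ) ^ n)
          * (∑ᶠ P ∈ {P : Polynomial Fq | P.Monic ∧ Irreducible P ∧ P ∣ Polynomial.X * Δ},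
              (P.natDegree : ℝ) * (ordP P (φ^[n] x) : ℝ)) := by
  have hq1 : 1 < q := hq ▸ Fintype.one_lt_card
  have hΘ1 : 1 < Θ := by rw [hΘ]; exact Nat.one_lt_pow (by norm_num) hq1
  have hΘr : (1 : ℝ) < Θ := by exact_mod_cast hΘ1
  set D : ℕ := max 1 (max g.natDegree Δ.natDegree) with hD
  have hstep : ∀ y, (φ y).natDegree ≤ D + Θ * y.natDegree := by
    intro y
    have hqΘ : q ≤ Θ := by rw [hΘ]; nlinarith
    rw [hφ]
    refine (natDegree_add_le _ _).trans (max_le ((natDegree_add_le _ _).trans (max_le ?_ ?_)) ?_)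
    · refine natDegree_mul_le.trans (add_le_add ?_ ?_)
      · rw [natDegree_X]; exact le_max_left _ _
      · nlinarith
    · refine natDegree_mul_le.trans (add_le_add ?_ ?_)
      · exact (le_max_left _ _).trans (le_max_right _ _)
      · exact natDegree_pow_le.trans (Nat.mul_le_mul_right _ hqΘ)
    · refine natDegree_mul_le.trans (add_le_add ?_ ?_)
      · exact (le_max_right _ _).trans (le_max_right _ _)
      · rw [hΘ]; exact natDegree_pow_le
  have hMD : (D : ℝ) = (Θ - 1) * M'φ := by
    have h : (Θ : ℝ) = (q : ℝ) ^ 2 := by rw [hΘ]; push_cast; rfl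
    rw [hM', ← h]
    have : (Θ : ℝ) - 1 ≠ 0 := by linarith
    field_simp
  have hM0 : 0 ≤ M'φ := by
    have : (0 : ℝ) ≤ D := Nat.cast_nonneg _
    rw [hMD] at this
    exact nonneg_of_mul_nonneg_right this (by linarith)
  have hind : ∀ m, ((φ^[m + n] x).natDegree : ℝ) + M'φ
      ≤ (Θ : ℝ) ^ m * ((φ^[n] x).natDegree + M'φ) := by
    intro m
    induction m with
    | zero => simp
    | succ m ih =>
      have h1 : ((φ (φ^[m + n] x)).natDegree : ℝ) ≤ D + Θ * (φ^[m + n] x).natDegree := by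
        exact_mod_cast hstep _
      rw [show m + 1 + n = (m + n) + 1 by ring, Function.iterate_succ_apply', pow_succ']
      have h2 := mul_le_mul_of_nonneg_left ih (by linarith : (0 : ℝ) ≤ Θ)
      rw [hMD] at h1
      linarith
  have hle : L ≤ ((φ^[n] x).natDegree + M'φ) / (Θ : ℝ) ^ n := by
    refine le_of_tendsto ((tendsto_add_atTop_iff_nat n).2 hL) (Eventually.of_forall fun m => ?_)
    have hp : (0 : ℝ) < (Θ : ℝ) ^ m := by positivity
    have hp' : (0 : ℝ) < (Θ : ℝ) ^ n := by positivity
    rw [div_le_div_iff₀ (by positivity) hp', pow_add]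
    have := mul_le_mul_of_nonneg_right (hind m) hp'.le
    have := mul_nonneg hM0 hp'.le
    linarith
  have hsum := sum_aux (φ^[n] x) (Polynomial.X * Δ) hne
  rw [← hsum] at hle
  rw [sub_le_iff_le_add]
  refine hle.trans (le_of_eq ?_)
  ring
end

section
/- Let g, Δ ∈ 𝔽_q[T] with Δ ≠ 0 and let φ_T(x) = T·x + g·x^q + Δ·x^{q²}. Let α ∈ 𝔽_q(T) be a point that is not a torsion point of φ, and suppose the sequence n ↦ h(φ_{T^n}(α))/q^{2n} converges to a real number L (the canonical height ĥ_φ(α)). Then L > q^{−6 − 12(q² − 1)·|S|}. -/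
open Polynomial UniqueFactorizationMonoid Filter

/-! ### Local analysis at one valuation -/

section LocalAnalysis

variable {K : Type*} [Field K] {Γ : Type*} [LinearOrderedCommGroupWithZero Γ]

/-- `y` is large at `v`: the top term of the Drinfeld module strictly dominates. -/
def DLarge (v : Valuation K Γ) (q : ℕ) (T G D y : K) : Prop :=
  1 < v D * v y ^ (q ^ 2 - 1) ∧ v T < v D * v y ^ (q ^ 2 - 1) ∧
    v G * v y ^ (q - 1) < v D * v y ^ (q ^ 2 - 1)

/-- the multiplier `φ(y)/y`. -/
def dmult (q : ℕ) (T G D y : K) : K := T + G * y ^ (q - 1) + D * y ^ (q ^ 2 - 1)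

theorem dmult_spec {q : ℕ} (hq : 2 ≤ q) (T G D y : K) :
    T * y + G * y ^ q + D * y ^ q ^ 2 = y * dmult q T G D y := by
  have h1 : y ^ q = y ^ (q - 1) * y := by
    rw [← pow_succ]; congr 1; omega
  have h2 : y ^ q ^ 2 = y ^ (q ^ 2 - 1) * y := by
    rw [← pow_succ]; congr 1
    have : 0 < q ^ 2 := by positivity
    omega
  rw [h1, h2, dmult]; ring

theorem sq_arith {q : ℕ} (hq : 2 ≤ q) : q + 1 ≤ q ^ 2 - 1 := by
  have : q * 2 ≤ q ^ 2 := by nlinarith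
  rcases Nat.lt_or_ge q 3 with h | h
  · have : q = 2 := by omega
    subst this; norm_num
  · omega

theorem dlarge_mono {q : ℕ} (hq : 2 ≤ q) (v : Valuation K Γ) {T G D y z : K}
    (h : DLarge v q T G D y) (hyz : v y ≤ v z) : DLarge v q T G D z := by
  obtain ⟨h1, h2, h3⟩ := h
  have hs := sq_arith hq
  have hy0 : v y ≠ 0 := by
    intro h0
    rw [h0, zero_pow (by omega), mul_zero] at h1
    exact absurd h1 (not_lt.mpr zero_le_one)
  have hle : v D * v y ^ (q ^ 2 - 1) ≤ v D * v z ^ (q ^ 2 - 1) := by gcongr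
  refine ⟨h1.trans_le hle, h2.trans_le hle, ?_⟩
  have hz0 : 0 < v z := lt_of_lt_of_le (zero_lt_iff.mpr hy0) hyz
  have hsplit : ∀ r : Γ, r ^ (q ^ 2 - 1) = r ^ (q ^ 2 - q) * r ^ (q - 1) := by
    intro r; rw [← pow_add]; congr 1
    have : q ≤ q ^ 2 := by nlinarith
    omega
  rw [hsplit, ← mul_assoc] at h3 ⊢
  have h4 : v G < v D * v y ^ (q ^ 2 - q) := lt_of_mul_lt_mul_right h3 zero_le
  have h5 : v D * v y ^ (q ^ 2 - q) ≤ v D * v z ^ (q ^ 2 - q) := by gcongr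
  exact mul_lt_mul_of_pos_right (h4.trans_le h5) (pow_pos hz0 _)

theorem dlarge_step {q : ℕ} (hq : 2 ≤ q) (v : Valuation K Γ) {T G D y : K}
    (hd : 1 ≤ v D * v y ^ (q ^ 2 - 1)) (hm : 1 < v (dmult q T G D y))
    (hT : v T ≤ v (dmult q T G D y)) (hG : v G * v y ^ (q - 1) ≤ v (dmult q T G D y)) :
    DLarge v q T G D (y * dmult q T G D y) := by
  have hs := sq_arith hq
  unfold DLarge
  set m := v (dmult q T G D y) with hmdef
  have e : ∀ n, v (y * dmult q T G D y) ^ n = v y ^ n * m ^ n := by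
    intro n; rw [map_mul, mul_pow]
  rw [e, e, ← mul_assoc, ← mul_assoc]
  have hle : m ^ (q ^ 2 - 1) ≤ v D * v y ^ (q ^ 2 - 1) * m ^ (q ^ 2 - 1) :=
    le_mul_of_one_le_left zero_le hd
  refine ⟨?_, ?_, ?_⟩
  · exact (one_lt_pow₀ hm (by omega)).trans_le hle
  · refine lt_of_lt_of_le ?_ hle
    calc v T ≤ m ^ 1 := by simpa using hT
      _ < _ := pow_lt_pow_right₀ hm (by omega)
  · refine lt_of_lt_of_le ?_ hle
    calc _ ≤ m * m ^ (q - 1) := by gcongr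
      _ = m ^ q := by rw [← pow_succ']; congr 1; omega
      _ < _ := pow_lt_pow_right₀ hm (by omega)

theorem dlarge_mult {q : ℕ} (v : Valuation K Γ) {T G D y : K}
    (h : DLarge v q T G D y) : v (dmult q T G D y) = v D * v y ^ (q ^ 2 - 1) := by
  obtain ⟨h1, h2, h3⟩ := h
  rw [dmult, Valuation.map_add_eq_of_lt_right]
  · simp
  · refine v.map_add_lt ?_ ?_ <;> simpa

theorem dlarge_phi {q : ℕ} (hq : 2 ≤ q) (v : Valuation K Γ) {T G D y : K}
    (h : DLarge v q T G D y) : DLarge v q T G D (y * dmult q T G D y) ∧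
      v D * v (y * dmult q T G D y) ^ (q ^ 2 - 1) = (v D * v y ^ (q ^ 2 - 1)) ^ q ^ 2 := by
  have hm := dlarge_mult v h
  refine ⟨dlarge_step hq v h.1.le (hm ▸ h.1) (hm ▸ h.2.1.le) (hm ▸ h.2.2.le), ?_⟩
  have hp : 0 < q ^ 2 := by positivity
  rw [map_mul, hm, mul_pow, ← mul_assoc, ← pow_succ']
  congr 1; omega

/-- At a place where `|T| > 1`: cancellation forces one of three coincidences. -/
theorem crit_infty {q : ℕ} (hq : 2 ≤ q) (v : Valuation K Γ) {T G D y : K} (hT : 1 < v T)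
    (hd : 1 ≤ v D * v y ^ (q ^ 2 - 1)) (hn : ¬ DLarge v q T G D (y * dmult q T G D y)) :
    v T = v G * v y ^ (q - 1) ∨ v T = v D * v y ^ (q ^ 2 - 1) ∨
      v G * v y ^ (q - 1) = v D * v y ^ (q ^ 2 - 1) := by
  by_contra! hne
  obtain ⟨h1, h2, h3⟩ := hne
  have hm : v (dmult q T G D y) =
      max (max (v T) (v G * v y ^ (q - 1))) (v D * v y ^ (q ^ 2 - 1)) := by
    have e1 : v (T + G * y ^ (q - 1)) = max (v T) (v G * v y ^ (q - 1)) := by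
      rw [Valuation.map_add_of_distinct_val] <;> simp [*]
    rw [dmult, Valuation.map_add_of_distinct_val, e1]
    · simp
    · rw [e1]
      rcases max_choice (v T) (v G * v y ^ (q - 1)) with h | h <;> rw [h] <;> simpa
  have hTm : v T ≤ v (dmult q T G D y) := by rw [hm]; simp
  exact hn (dlarge_step hq v hd (hT.trans_le hTm) hTm (by rw [hm]; simp))

/-- At a place where `|T| ≤ 1`. -/
theorem crit_fin {q : ℕ} (hq : 2 ≤ q) (v : Valuation K Γ) {T G D y : K} (hT : v T ≤ 1)
    (hd : 1 < v D * v y ^ (q ^ 2 - 1)) (hn : ¬ DLarge v q T G D (y * dmult q T G D y)) :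
    v G * v y ^ (q - 1) = v D * v y ^ (q ^ 2 - 1) ∧
      v (G * y ^ (q - 1) + D * y ^ (q ^ 2 - 1)) < v D * v y ^ (q ^ 2 - 1) := by
  have key : ¬ (v D * v y ^ (q ^ 2 - 1) ≤ v (dmult q T G D y) ∧
      v G * v y ^ (q - 1) ≤ v (dmult q T G D y)) := by
    rintro ⟨a, b⟩
    exact hn (dlarge_step hq v hd.le (hd.trans_le a) (hT.trans (hd.le.trans a)) b)
  have hass : dmult q T G D y = T + (G * y ^ (q - 1) + D * y ^ (q ^ 2 - 1)) := by
    rw [dmult, add_assoc]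
  by_cases hbd : v G * v y ^ (q - 1) = v D * v y ^ (q ^ 2 - 1)
  · refine ⟨hbd, ?_⟩
    rw [hbd, and_self, not_le] at key
    have : G * y ^ (q - 1) + D * y ^ (q ^ 2 - 1) = dmult q T G D y - T := by rw [hass]; ring
    rw [this]
    exact v.map_sub_lt key (hT.trans_lt hd)
  · exfalso
    have e1 : v (G * y ^ (q - 1) + D * y ^ (q ^ 2 - 1)) =
        max (v G * v y ^ (q - 1)) (v D * v y ^ (q ^ 2 - 1)) := by
      rw [Valuation.map_add_of_distinct_val] <;> simp [*]
    have e2 : v (dmult q T G D y) = max (v G * v y ^ (q - 1)) (v D * v y ^ (q ^ 2 - 1)) := by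
      rw [hass, Valuation.map_add_eq_of_lt_right, e1]
      rw [e1]; exact (hT.trans_lt hd).trans_le (le_max_right _ _)
    exact key (by rw [e2]; simp)

end LocalAnalysis

section LinearAlgebra

variable {F K : Type*} [Field F] [Field K] [Algebra F K]
  {Γ : Type*} [LinearOrderedCommGroupWithZero Γ]

theorem codim_one (V W : Submodule F K) [FiniteDimensional F V] (z : K)
    (h : ∀ y ∈ V, ∃ c : F, y - c • z ∈ W) (hz : z ∈ V) :
    Module.finrank F V ≤ Module.finrank F ↥(V ⊓ W) + 1 := by
  have hle : V ≤ (V ⊓ W) ⊔ Submodule.span F {z} := by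
    intro y hy
    obtain ⟨c, hc⟩ := h y hy
    have : y = (y - c • z) + c • z := by abel
    rw [this]
    exact Submodule.add_mem_sup ⟨V.sub_mem hy (V.smul_mem c hz), hc⟩
      (Submodule.smul_mem _ _ (Submodule.mem_span_singleton_self z))
  have : FiniteDimensional F ↥(V ⊓ W) := Submodule.finiteDimensional_of_le inf_le_left
  calc Module.finrank F V ≤ _ := Submodule.finrank_mono hle
    _ ≤ Module.finrank F ↥(V ⊓ W) + Module.finrank F ↥(Submodule.span F {z}) :=
      Submodule.finrank_add_le_finrank_add_finrank _ _
    _ ≤ _ := by gcongr; exact (finrank_span_le_card ({z} : Set K)).trans (by simp)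

/-- A submodule attached to a downward closed set of values. -/
def ballSub (v : Valuation K Γ) (hF : ∀ c : F, v (algebraMap F K c) ≤ 1) (P : Γ → Prop)
    (hP : ∀ r s, r ≤ s → P s → P r) (h0 : P 0) : Submodule F K where
  carrier := {y | P (v y)}
  zero_mem' := by simpa using h0
  add_mem' := by
    intro a b ha hb
    rcases v.map_add' a b with h | h
    · exact hP _ _ h ha
    · exact hP _ _ h hb
  smul_mem' := by
    intro c x hx
    refine hP _ _ ?_ hx
    rw [Algebra.smul_def, map_mul]
    exact mul_le_of_le_one_left zero_le (hF c)

theorem infty_step (v : Valuation K Γ) (hF : ∀ c : F, v (algebraMap F K c) ≤ 1)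
    (hres : ∀ u : K, v u = 1 → ∃ c : F, v (u - algebraMap F K c) < 1)
    (P : Γ → Prop) (hP : ∀ r s, r ≤ s → P s → P r) (h0 : P 0) (n : ℕ) :
    ∀ (R : Finset Γ) (_ : R.card ≤ n) (V : Submodule F K) (_ : FiniteDimensional F V)
      (_ : ∀ y ∈ V, P (v y) ∨ v y ∈ R),
      ∃ V' ≤ V, (∀ y ∈ V', P (v y)) ∧ Module.finrank F V ≤ Module.finrank F V' + n := by
  induction n with
  | zero =>
    intro R hR V _ hV
    refine ⟨V, le_rfl, fun y hy => ?_, by simp⟩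
    have : R = ∅ := by simpa using hR
    simpa [this] using hV y hy
  | succ n ih =>
    intro R hR V hfd hV
    by_cases hall : ∀ y ∈ V, P (v y)
    · exact ⟨V, le_rfl, hall, by omega⟩
    push Not at hall
    obtain ⟨y0, hy0, hb0⟩ := hall
    classical
    let B : Finset Γ := R.filter (fun r => ∃ y ∈ V, ¬ P (v y) ∧ v y = r)
    have hB : B.Nonempty :=
      ⟨v y0, Finset.mem_filter.mpr ⟨(hV y0 hy0).resolve_left hb0, y0, hy0, hb0, rfl⟩⟩
    obtain ⟨hrR, z, hzV, hzb, hzr⟩ := Finset.mem_filter.mp (B.max'_mem hB)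
    have hmax : ∀ y ∈ V, ¬ P (v y) → v y ≤ v z := by
      intro y hy hb
      rw [hzr]
      exact B.le_max' _ (Finset.mem_filter.mpr ⟨(hV y hy).resolve_left hb, y, hy, hb, rfl⟩)
    have hgood : ∀ y, P (v y) → v y < v z := by
      intro y hy
      by_contra! h
      exact hzb (hP _ _ h hy)
    have hz0 : v z ≠ 0 := fun h => hzb (by rw [h]; exact h0)
    have hzpos : 0 < v z := zero_lt_iff.mpr hz0
    let W : Submodule F K := ballSub v hF (fun r => r < v z) (fun r s h1 h2 => h1.trans_lt h2) hzpos
    have hcod := codim_one V W z (by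
      intro y hy
      by_cases hlt : v y < v z
      · exact ⟨0, by rw [zero_smul, sub_zero]; exact hlt⟩
      · have hyb : ¬ P (v y) := fun h => hlt (hgood y h)
        have heq : v y = v z := le_antisymm (hmax y hy hyb) (not_lt.mp hlt)
        obtain ⟨c, hc⟩ := hres (y / z) (by rw [map_div₀, heq, div_self hz0])
        refine ⟨c, ?_⟩
        have hzne : z ≠ 0 := fun h => hz0 (by simp [h])
        have : y - c • z = (y / z - algebraMap F K c) * z := by
          rw [Algebra.smul_def]; field_simp
        rw [this]
        change v _ < v z
        rw [map_mul]
        simpa using mul_lt_mul_of_pos_right hc hzpos) hzV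
    have : FiniteDimensional F ↥(V ⊓ W) := Submodule.finiteDimensional_of_le inf_le_left
    obtain ⟨V', hV', hPV', hr⟩ := ih (R.erase (v z)) (by
      rw [Finset.card_erase_of_mem (hzr ▸ hrR)]; omega) (V ⊓ W) inferInstance (by
        rintro y ⟨hy, hyW⟩
        rcases hV y hy with h | h
        · exact Or.inl h
        · exact Or.inr (Finset.mem_erase.mpr ⟨ne_of_lt hyW, h⟩))
    exact ⟨V', hV'.trans inf_le_left, hPV', by omega⟩

end LinearAlgebra
section FiniteStep

variable {F K : Type*} [Field F] [Fintype F] [Field K] [Algebra F K]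
  {Γ : Type*} [LinearOrderedCommGroupWithZero Γ]

theorem exists_close (v : Valuation K Γ) {w : K} (h : v (w ^ Fintype.card F - w) < 1) :
    ∃ c : F, v (w - algebraMap F K c) < 1 := by
  have hprod : w ^ Fintype.card F - w = ∏ c : F, (w - algebraMap F K c) := by
    have h1 : (∏ c : F, (X - C c)) = (X ^ Fintype.card F - X : F[X]) := by
      have hm : (X ^ Fintype.card F - X : F[X]).Monic := by
        apply monic_X_pow_sub
        rw [degree_X]
        exact_mod_cast Fintype.one_lt_card
      have := prod_multiset_X_sub_C_of_monic_of_roots_card_eq hm (by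
        rw [FiniteField.roots_X_pow_card_sub_X,
          FiniteField.X_pow_card_sub_X_natDegree_eq F Fintype.one_lt_card]
        rfl)
      rw [FiniteField.roots_X_pow_card_sub_X] at this
      exact this
    have h2 := congrArg (aeval w) h1
    simp only [map_prod, map_sub, aeval_X, aeval_C, map_pow] at h2
    exact h2.symm
  by_contra! hc
  rw [hprod, map_prod] at h
  exact absurd h (not_lt.mpr (Finset.one_le_prod'' (fun c => hc c)))

theorem frob_sub {q : ℕ} (hq : q = Fintype.card F) (a b : K) : (a - b) ^ q = a ^ q - b ^ q := by
  obtain ⟨p, hp⟩ := CharP.exists F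
  obtain ⟨n, hpp, hn⟩ := FiniteField.card F p
  have : Fact p.Prime := ⟨hpp⟩
  have : CharP K p := charP_of_injective_algebraMap (algebraMap F K).injective p
  rw [hq, hn]
  exact sub_pow_char_pow ..

theorem fin_step {q : ℕ} (hqF : q = Fintype.card F) (hq : 2 ≤ q)
    (v : Valuation K Γ) (hF : ∀ c : F, v (algebraMap F K c) ≤ 1)
    {T G D : K} (hD : D ≠ 0) (hT : v T ≤ 1) (V : Submodule F K) [FiniteDimensional F V]
    (hn : ∀ y ∈ V, ¬ DLarge v q T G D (y * dmult q T G D y)) :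
    ∃ V' ≤ V, (∀ y ∈ V', v D * v y ^ (q ^ 2 - 1) ≤ 1) ∧
      Module.finrank F V ≤ Module.finrank F V' + 1 := by
  by_cases hall : ∀ y ∈ V, v D * v y ^ (q ^ 2 - 1) ≤ 1
  · exact ⟨V, le_rfl, hall, by omega⟩
  push Not at hall
  obtain ⟨z, hzV, hz⟩ := hall
  have hs := sq_arith hq
  have hqq : 2 * q ≤ q ^ 2 := by nlinarith
  have hvD : v D ≠ 0 := (v.ne_zero_iff).mpr hD
  set k := q ^ 2 - q with hk
  have hne : ∀ y, 1 < v D * v y ^ (q ^ 2 - 1) → v y ≠ 0 := by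
    intro y hy h0
    rw [h0, zero_pow (by omega), mul_zero] at hy
    exact absurd hy (not_lt.mpr zero_le_one)
  have hsplit : q ^ 2 - 1 = k + (q - 1) := by omega
  -- critical elements
  have crit : ∀ y ∈ V, 1 < v D * v y ^ (q ^ 2 - 1) →
      v G = v D * v y ^ k ∧ v (G + D * y ^ k) < v G := by
    intro y hy hb
    obtain ⟨h1, h2⟩ := crit_fin hq v hT hb (hn y hy)
    have hy0 := hne y hb
    have hp : 0 < v y ^ (q - 1) := pow_pos (zero_lt_iff.mpr hy0) _
    have e1 : v G = v D * v y ^ k := by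
      rw [hsplit, pow_add, ← mul_assoc] at h1
      exact mul_right_cancel₀ hp.ne' h1
    refine ⟨e1, ?_⟩
    rw [← h1] at h2
    have : G * y ^ (q - 1) + D * y ^ (q ^ 2 - 1) = (G + D * y ^ k) * y ^ (q - 1) := by
      rw [hsplit, pow_add]; ring
    rw [this, map_mul, map_pow] at h2
    exact lt_of_mul_lt_mul_right h2 zero_le
  have hz0 := hne z hz
  have hzpos : 0 < v z := zero_lt_iff.mpr hz0
  have hzne : z ≠ 0 := fun h => hz0 (by simp [h])
  obtain ⟨cz1, cz2⟩ := crit z hzV hz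
  let W : Submodule F K := ballSub v hF (fun r => v D * r ^ (q ^ 2 - 1) ≤ 1)
    (fun r s h1 h2 => le_trans (by gcongr) h2) (by
      rw [zero_pow (by omega), mul_zero]; exact zero_le_one)
  refine ⟨V ⊓ W, inf_le_left, fun y hy => hy.2, codim_one V W z ?_ hzV⟩
  intro y hy
  by_cases hyb : v D * v y ^ (q ^ 2 - 1) ≤ 1
  · exact ⟨0, by rw [zero_smul, sub_zero]; exact hyb⟩
  rw [not_le] at hyb
  obtain ⟨cy1, cy2⟩ := crit y hy hyb
  have hy0 := hne y hyb
  have hk0 : k ≠ 0 := by omega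
  have hvk : v y ^ k = v z ^ k := by
    have := cy1.symm.trans cz1
    exact mul_left_cancel₀ hvD this
  have hvyz : v y = v z := (pow_left_inj₀ zero_le zero_le hk0).mp hvk
  set w := y / z with hw
  have hvw : v w = 1 := by rw [hw, map_div₀, hvyz, div_self hz0]
  have h1 : v (w ^ k - 1) < 1 := by
    have e : D * z ^ k * (w ^ k - 1) = (G + D * y ^ k) - (G + D * z ^ k) := by
      have hzk : z ^ k ≠ 0 := pow_ne_zero _ hzne
      rw [hw, div_pow]; field_simp; ring
    have h2 : v (D * z ^ k * (w ^ k - 1)) < v G := by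
      rw [e]; exact v.map_sub_lt cy2 cz2
    rw [map_mul, map_mul, map_pow, ← cz1] at h2
    have hG0 : 0 < v G := by
      rw [cz1]; exact mul_pos (zero_lt_iff.mpr hvD) (pow_pos hzpos _)
    exact lt_of_mul_lt_mul_left (by simpa using h2) hG0.le
  have hkq : k = (q - 1) * q := by
    rw [hk, Nat.sub_mul, sq, one_mul]
  have h3 : v (w ^ (q - 1) - 1) < 1 := by
    have : w ^ k - 1 = (w ^ (q - 1) - 1) ^ q := by
      rw [frob_sub hqF, ← pow_mul, hkq, one_pow]
    rw [this, map_pow] at h1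
    exact lt_of_pow_lt_pow_left₀ q zero_le_one (by simpa using h1)
  obtain ⟨c, hc⟩ := exists_close (F := F) v (w := w) (by
    rw [← hqF]
    have : w ^ q - w = w * (w ^ (q - 1) - 1) := by
      rw [mul_sub, ← pow_succ', mul_one]; congr 2; omega
    rw [this, map_mul, hvw, one_mul]; exact h3)
  refine ⟨c, ?_⟩
  have e : y - c • z = (w - algebraMap F K c) * z := by
    rw [Algebra.smul_def, hw]; field_simp
  have hlt : v (y - c • z) < v z := by
    rw [e, map_mul]
    simpa using mul_lt_mul_of_pos_right hc hzpos
  change v D * v (y - c • z) ^ (q ^ 2 - 1) ≤ 1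
  by_contra! hb
  obtain ⟨c1, -⟩ := crit _ (V.sub_mem hy (V.smul_mem c hzV)) hb
  have := mul_left_cancel₀ hvD (c1.symm.trans cz1)
  exact hlt.ne ((pow_left_inj₀ zero_le zero_le hk0).mp this)

/-- a place of good reduction needs no condition. -/
theorem fin_good {q : ℕ} (hq : 2 ≤ q) (v : Valuation K Γ) {T G D : K} (hD : v D = 1)
    (hT : v T ≤ 1) (hG : v G ≤ 1) {y : K}
    (hn : ¬ DLarge v q T G D (y * dmult q T G D y)) : v D * v y ^ (q ^ 2 - 1) ≤ 1 := by
  by_contra! hb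
  have hs := sq_arith hq
  obtain ⟨h1, -⟩ := crit_fin hq v hT hb hn
  have hy : 1 < v y := by
    by_contra! h
    exact absurd hb (not_lt.mpr (by rw [hD, one_mul]; exact pow_le_one₀ zero_le h))
  have h2 : v y ^ (q - 1) < v y ^ (q ^ 2 - 1) := pow_lt_pow_right₀ hy (by omega)
  rw [hD, one_mul] at h1
  rw [← h1] at h2
  exact absurd h2 (not_lt.mpr (mul_le_of_le_one_left zero_le hG))

/-- the infinite place: three critical values. -/
theorem infty_place {q : ℕ} (hq : 2 ≤ q) (v : Valuation K Γ)
    (hF : ∀ c : F, v (algebraMap F K c) ≤ 1)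
    (hres : ∀ u : K, v u = 1 → ∃ c : F, v (u - algebraMap F K c) < 1)
    {T G D : K} (hD : D ≠ 0) (hT : 1 < v T) (V : Submodule F K) [hfd : FiniteDimensional F V]
    (hn : ∀ y ∈ V, ¬ DLarge v q T G D (y * dmult q T G D y)) :
    ∃ V' ≤ V, (∀ y ∈ V', v D * v y ^ (q ^ 2 - 1) < 1) ∧
      Module.finrank F V ≤ Module.finrank F V' + 3 := by
  classical
  have hs := sq_arith hq
  have hvD : v D ≠ 0 := (v.ne_zero_iff).mpr hD
  have hsub : ∀ s : Set Γ, s.Subsingleton → ∃ t : Finset Γ, t.card ≤ 1 ∧ ∀ x ∈ s, x ∈ t := by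
    intro s hs
    rcases hs.eq_empty_or_singleton with h | ⟨a, h⟩
    · exact ⟨∅, by simp, by simp [h]⟩
    · exact ⟨{a}, by simp, by simp [h]⟩
  have hT0 : v T ≠ 0 := (zero_lt_one.trans hT).ne'
  obtain ⟨t1, c1, m1⟩ := hsub {r | v T = v G * r ^ (q - 1)} (by
    intro r hr s hs'
    simp only [Set.mem_ofPred_eq] at hr hs'
    have hG0 : v G ≠ 0 := by rintro h; rw [h, zero_mul] at hr; exact hT0 hr
    have := mul_left_cancel₀ hG0 (hr.symm.trans hs')
    exact (pow_left_inj₀ zero_le zero_le (by omega)).mp this)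
  obtain ⟨t2, c2, m2⟩ := hsub {r | v T = v D * r ^ (q ^ 2 - 1)} (by
    intro r hr s hs'
    simp only [Set.mem_ofPred_eq] at hr hs'
    have := mul_left_cancel₀ hvD (hr.symm.trans hs')
    exact (pow_left_inj₀ zero_le zero_le (by omega)).mp this)
  obtain ⟨t3, c3, m3⟩ := hsub {r | r ≠ 0 ∧ v G * r ^ (q - 1) = v D * r ^ (q ^ 2 - 1)} (by
    have key : ∀ r : Γ, r ≠ 0 → v G * r ^ (q - 1) = v D * r ^ (q ^ 2 - 1) →
        v G = v D * r ^ (q ^ 2 - q) := by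
      intro r hr h
      have : q ^ 2 - 1 = (q ^ 2 - q) + (q - 1) := by omega
      rw [this, pow_add, ← mul_assoc] at h
      exact mul_right_cancel₀ (pow_ne_zero _ hr) h
    rintro r ⟨hr0, hr⟩ s ⟨hs0, hs'⟩
    have := mul_left_cancel₀ hvD ((key r hr0 hr).symm.trans (key s hs0 hs'))
    exact (pow_left_inj₀ zero_le zero_le (by omega)).mp this)
  refine infty_step v hF hres (fun r => v D * r ^ (q ^ 2 - 1) < 1)
    (fun r s h1 h2 => lt_of_le_of_lt (by gcongr) h2)
    (by rw [zero_pow (by omega), mul_zero]; exact zero_lt_one) 3 (t1 ∪ t2 ∪ t3) ?_ V hfd ?_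
  · have := Finset.card_union_le (t1 ∪ t2) t3
    have := Finset.card_union_le t1 t2
    omega
  · intro y hy
    by_cases hd : v D * v y ^ (q ^ 2 - 1) < 1
    · exact Or.inl hd
    rw [not_lt] at hd
    right
    have hy0 : v y ≠ 0 := by
      intro h0
      rw [h0, zero_pow (by omega), mul_zero] at hd
      exact absurd hd (not_le.mpr zero_lt_one)
    simp only [Finset.mem_union]
    rcases crit_infty hq v hT hd (hn y hy) with h | h | h
    · exact Or.inl (Or.inl (m1 _ h))
    · exact Or.inl (Or.inr (m2 _ h))
    · exact Or.inr (m3 _ ⟨hy0, h⟩)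

end FiniteStep
section Global

open WithZero IsDedekindDomain

variable {F : Type*} [Field F]

/-- the naive height. -/
noncomputable def nht (x : RatFunc F) : ℕ := max x.num.natDegree x.denom.natDegree

theorem fin_val_poly (v : HeightOneSpectrum F[X]) {r : F[X]} (hr : r ≠ 0) :
    exp (-(r.natDegree : ℤ)) ≤ v.intValuation r := by
  rw [v.intValuation_eq_exp_neg_multiplicity hr, exp_le_exp, neg_le_neg_iff, Nat.cast_le]
  set k := multiplicity v.asIdeal (Ideal.span {r})
  have hdvd : v.asIdeal ^ k ∣ Ideal.span {r} := pow_multiplicity_dvd _ _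
  obtain ⟨p, hp⟩ := (IsPrincipalIdealRing.principal v.asIdeal).principal
  have hp' : v.asIdeal = Ideal.span {p} := hp
  rw [hp', Ideal.span_singleton_pow, Ideal.span_singleton_dvd_span_singleton_iff_dvd] at hdvd
  have hp0 : p ≠ 0 := by
    rintro rfl
    exact v.ne_bot (by simpa using hp')
  have hpu : ¬ IsUnit p := by
    intro hu
    exact v.isPrime.ne_top (by rw [hp']; exact Ideal.span_singleton_eq_top.mpr hu)
  have hpd : 0 < p.natDegree := by
    by_contra! h0
    exact hpu (isUnit_iff_degree_eq_zero.mpr (by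
      rw [degree_eq_natDegree hp0]; simpa using h0))
  have := natDegree_le_of_dvd hdvd hr
  rw [natDegree_pow] at this
  nlinarith

theorem fin_val_le (v : HeightOneSpectrum F[X]) (x : RatFunc F) :
    v.valuation (RatFunc F) x ≤ exp (nht x : ℤ) := by
  have h1 : v.valuation (RatFunc F) x =
      v.intValuation x.num / v.intValuation x.denom := by
    conv_lhs => rw [← RatFunc.num_div_denom x]
    rw [map_div₀, v.valuation_of_algebraMap, v.valuation_of_algebraMap]
  rw [h1]
  have h2 := fin_val_poly v x.denom_ne_zero
  have h3 := v.intValuation_le_one x.num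
  have h4 : exp (-(nht x : ℤ)) ≤ v.intValuation x.denom := by
    refine le_trans ?_ h2
    rw [exp_le_exp, neg_le_neg_iff, Nat.cast_le]
    exact le_max_right _ _
  have h5 : 0 < v.intValuation x.denom := lt_of_lt_of_le exp_pos h4
  rw [div_le_iff₀ h5]
  calc _ ≤ (1 : ℤᵐ⁰) := h3
    _ = exp (nht x : ℤ) * exp (-(nht x : ℤ)) := by rw [← exp_add]; simp
    _ ≤ _ := by gcongr

theorem infty_val_le [DecidableEq (RatFunc F)] (x : RatFunc F) :
    RatFunc.inftyValuation F x ≤ exp (nht x : ℤ) := by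
  by_cases hx : x = 0
  · simp [hx]
  · rw [RatFunc.inftyValuation_apply, RatFunc.inftyValuation_of_nonzero F hx, exp_le_exp,
      RatFunc.intDegree]
    have : x.num.natDegree ≤ nht x := le_max_left _ _
    omega

theorem infty_val_poly [DecidableEq (RatFunc F)] {p : F[X]} (hp : p ≠ 0) :
    RatFunc.inftyValuation F (algebraMap F[X] (RatFunc F) p) = exp (p.natDegree : ℤ) := by
  rw [RatFunc.inftyValuation_apply, RatFunc.inftyValuation.polynomial F hp]

theorem infty_const [DecidableEq (RatFunc F)] (c : F) :
    RatFunc.inftyValuation F (algebraMap F (RatFunc F) c) ≤ 1 := by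
  by_cases hc : c = 0
  · simp [hc]
  · rw [RatFunc.algebraMap_eq_C, RatFunc.inftyValuation.C F hc]

theorem fin_const (v : HeightOneSpectrum F[X]) (c : F) :
    v.valuation (RatFunc F) (algebraMap F (RatFunc F) c) ≤ 1 := by
  rw [IsScalarTower.algebraMap_apply F F[X] (RatFunc F)]
  exact v.valuation_le_one _

theorem infty_res [DecidableEq (RatFunc F)] (u : RatFunc F) (hu : RatFunc.inftyValuation F u = 1) :
    ∃ c : F, RatFunc.inftyValuation F (u - algebraMap F (RatFunc F) c) < 1 := by
  have hu0 : u ≠ 0 := by rintro rfl; simp at hu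
  have hn0 : u.num ≠ 0 := RatFunc.num_ne_zero hu0
  have hd0 := u.denom_ne_zero
  have hdeg : u.num.natDegree = u.denom.natDegree := by
    rw [RatFunc.inftyValuation_apply, RatFunc.inftyValuation_of_nonzero F hu0, exp_eq_one,
      RatFunc.intDegree] at hu
    omega
  refine ⟨u.num.leadingCoeff, ?_⟩
  set c := u.num.leadingCoeff with hc
  have hc0 : c ≠ 0 := leadingCoeff_ne_zero.mpr hn0
  have e : u - algebraMap F (RatFunc F) c =
      algebraMap F[X] (RatFunc F) (u.num - C c * u.denom) / algebraMap F[X] (RatFunc F) u.denom := by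
    have hne : algebraMap F[X] (RatFunc F) u.denom ≠ 0 := by simpa using hd0
    rw [map_sub, map_mul, sub_div, mul_div_assoc, div_self hne, RatFunc.num_div_denom, mul_one,
      RatFunc.algebraMap_eq_C, RatFunc.algebraMap_C]
  have hCd : degree (C c * u.denom) = degree u.denom := degree_C_mul hc0
  have hlt : degree (u.num - C c * u.denom) < degree u.num := by
    apply degree_sub_lt_left
    · rw [hCd, degree_eq_natDegree hn0, degree_eq_natDegree hd0, hdeg]
    · exact hn0
    · rw [leadingCoeff_mul, leadingCoeff_C, (RatFunc.monic_denom u).leadingCoeff, mul_one]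
  rw [e, map_div₀, infty_val_poly hd0, div_lt_iff₀ exp_pos, one_mul]
  by_cases h0 : u.num - C c * u.denom = 0
  · rw [h0, map_zero, map_zero]; exact exp_pos
  · rw [infty_val_poly h0, exp_lt_exp, Nat.cast_lt, ← hdeg]
    exact natDegree_lt_natDegree h0 hlt

/-- Large points have quickly growing height. -/
theorem growth {q : ℕ} (hq : 2 ≤ q) (v : Valuation (RatFunc F) ℤᵐ⁰) {T G D : RatFunc F}
    (hv : ∀ x, v x ≤ exp (nht x : ℤ)) {φ : RatFunc F → RatFunc F}
    (hφ : ∀ y, φ y = y * dmult q T G D y) {y : RatFunc F} (h : DLarge v q T G D y) (m : ℕ) :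
    q ^ (2 * m) ≤ nht D + (q ^ 2 - 1) * nht (φ^[m] y) := by
  have key : ∀ m, DLarge v q T G D (φ^[m] y) ∧
      v D * v (φ^[m] y) ^ (q ^ 2 - 1) = (v D * v y ^ (q ^ 2 - 1)) ^ q ^ (2 * m) := by
    intro m
    induction m with
    | zero => simpa using h
    | succ m ih =>
      rw [Function.iterate_succ_apply', hφ]
      obtain ⟨h1, h2⟩ := dlarge_phi hq v ih.1
      refine ⟨h1, ?_⟩
      rw [h2, ih.2, ← pow_mul, ← pow_add]
      congr 2
  have h1 : exp (1 : ℤ) ≤ v D * v y ^ (q ^ 2 - 1) := by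
    have hz : v D * v y ^ (q ^ 2 - 1) ≠ 0 := (zero_lt_one.trans h.1).ne'
    rw [← le_log_iff_exp_le hz]
    have : (0 : ℤ) < log (v D * v y ^ (q ^ 2 - 1)) := by
      rw [lt_log_iff_exp_lt hz]; exact h.1
    omega
  have h2 : exp ((q ^ (2 * m) : ℕ) : ℤ) ≤ exp ((nht D + (q ^ 2 - 1) * nht (φ^[m] y) : ℕ) : ℤ) := by
    calc exp ((q ^ (2 * m) : ℕ) : ℤ) = exp (1 : ℤ) ^ q ^ (2 * m) := by
          rw [← exp_nsmul]; simp
      _ ≤ (v D * v y ^ (q ^ 2 - 1)) ^ q ^ (2 * m) := by gcongr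
      _ = v D * v (φ^[m] y) ^ (q ^ 2 - 1) := ((key m).2).symm
      _ ≤ exp (nht D : ℤ) * exp (nht (φ^[m] y) : ℤ) ^ (q ^ 2 - 1) := by
          gcongr
          · exact hv _
          · exact hv _
      _ = _ := by
          rw [← exp_nsmul, ← exp_add]; congr 1
  rw [exp_le_exp] at h2
  exact_mod_cast h2

/-- Lower bound for the limit from one large iterate. -/
theorem limit_bound {q : ℕ} (hq : 2 ≤ q) (h : ℕ → ℕ) (C n : ℕ) (L : ℝ)
    (hL : Tendsto (fun n => (h n : ℝ) / (q : ℝ) ^ (2 * n)) atTop (nhds L))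
    (hg : ∀ m, q ^ (2 * m) ≤ C + (q ^ 2 - 1) * h (m + n)) :
    (1 : ℝ) / (((q : ℝ) ^ 2 - 1) * (q : ℝ) ^ (2 * n)) ≤ L := by
  have hq1 : (1 : ℝ) < q := by exact_mod_cast (by omega : 1 < q)
  have hq0 : (0 : ℝ) < (q : ℝ) ^ 2 - 1 := by nlinarith
  have t1 := (tendsto_add_atTop_iff_nat n).mpr hL
  have t2 : Tendsto (fun m : ℕ => (1 - C * (((q : ℝ) ^ 2)⁻¹) ^ m) /
      (((q : ℝ) ^ 2 - 1) * (q : ℝ) ^ (2 * n))) atTop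
      (nhds ((1 - C * 0) / (((q : ℝ) ^ 2 - 1) * (q : ℝ) ^ (2 * n)))) := by
    refine Tendsto.div_const (Tendsto.const_sub _ (Tendsto.const_mul _ ?_)) _
    apply tendsto_pow_atTop_nhds_zero_of_lt_one (by positivity)
    apply inv_lt_one_of_one_lt₀; nlinarith
  rw [mul_zero, sub_zero] at t2
  refine le_of_tendsto_of_tendsto' t2 t1 (fun m => ?_)
  have hm : (q : ℝ) ^ (2 * m) ≤ C + ((q : ℝ) ^ 2 - 1) * h (m + n) := by
    have := hg m
    have h2 : 1 ≤ q ^ 2 := Nat.one_le_pow _ _ (by omega)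
    have h3 : ((q ^ (2 * m) : ℕ) : ℝ) ≤ ((C + (q ^ 2 - 1) * h (m + n) : ℕ) : ℝ) := by
      exact_mod_cast this
    push_cast [Nat.cast_sub h2] at h3
    exact h3
  have hp : (0 : ℝ) < (q : ℝ) ^ (2 * m) := by positivity
  have hpn : (0 : ℝ) < (q : ℝ) ^ (2 * n) := by positivity
  rw [mul_add, pow_add, inv_pow, ← pow_mul, div_le_div_iff₀ (by positivity) (by positivity)]
  have : (1 - C * ((q : ℝ) ^ (2 * m))⁻¹) * ((q : ℝ) ^ (2 * m) * (q : ℝ) ^ (2 * n)) =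
      ((q : ℝ) ^ (2 * m) - C) * (q : ℝ) ^ (2 * n) := by field_simp
  rw [this, ← mul_assoc]
  gcongr
  linarith

end Global
section Assembly

open WithZero IsDedekindDomain

variable {F : Type*} [Field F] [Fintype F]

/-- the span of the first `n` iterates. -/
noncomputable def orbSpan (φ : RatFunc F → RatFunc F) (α : RatFunc F) (n : ℕ) :
    Submodule F (RatFunc F) :=
  Submodule.span F ((fun i => φ^[i] α) '' Set.Iio n)

theorem orbSpan_fd (φ : RatFunc F → RatFunc F) (α : RatFunc F) (n : ℕ) :
    FiniteDimensional F (orbSpan φ α n) :=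
  FiniteDimensional.span_of_finite F ((Set.finite_Iio n).image _)

theorem orbSpan_mem (φ : RatFunc F → RatFunc F) (α : RatFunc F) {i n : ℕ} (h : i < n) :
    φ^[i] α ∈ orbSpan φ α n := Submodule.subset_span ⟨i, h, rfl⟩

theorem orbSpan_mono (φ : RatFunc F → RatFunc F) (α : RatFunc F) {m n : ℕ} (h : m ≤ n) :
    orbSpan φ α m ≤ orbSpan φ α n :=
  Submodule.span_mono (Set.image_mono (fun _ hi => lt_of_lt_of_le hi h))

theorem orbSpan_map (L : RatFunc F →ₗ[F] RatFunc F) (α : RatFunc F) (n : ℕ) (y : RatFunc F)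
    (hy : y ∈ orbSpan L α n) : L y ∈ orbSpan L α (n + 1) := by
  have : (orbSpan L α n).map L ≤ orbSpan L α (n + 1) := by
    rw [orbSpan, Submodule.map_span, Submodule.span_le]
    rintro _ ⟨_, ⟨i, hi, rfl⟩, rfl⟩
    have := orbSpan_mem L α (Nat.succ_lt_succ hi)
    rw [Function.iterate_succ_apply'] at this
    exact this
  exact this ⟨y, hy, rfl⟩

theorem orbSpan_rank (L : RatFunc F →ₗ[F] RatFunc F) (α : RatFunc F)
    (htor : ¬ (Set.range fun n => L^[n] α).Finite) (n : ℕ) :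
    n ≤ Module.finrank F (orbSpan L α n) := by
  induction n with
  | zero => simp
  | succ n ih =>
    have := orbSpan_fd L α (n + 1)
    have hlt : orbSpan L α n < orbSpan L α (n + 1) := by
      refine lt_of_le_of_ne (orbSpan_mono L α (Nat.le_succ n)) ?_
      intro heq
      apply htor
      have hfd := orbSpan_fd L α (n + 1)
      have hfin : Finite (orbSpan L α (n + 1)) := Module.finite_of_finite F
      refine Set.Finite.subset (s := (orbSpan L α (n + 1) : Set (RatFunc F)))
        (Set.toFinite _) ?_
      rintro _ ⟨k, rfl⟩
      change L^[k] α ∈ orbSpan L α (n + 1)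
      induction k with
      | zero => exact orbSpan_mem L α (Nat.succ_pos n)
      | succ k ihk =>
        rw [Function.iterate_succ_apply']
        rw [← heq] at ihk
        exact orbSpan_map L α n _ ihk
    have := Submodule.finrank_lt_finrank_of_lt hlt
    omega

theorem orbSpan_not_large {q : ℕ} (hq : 2 ≤ q) (v : Valuation (RatFunc F) ℤᵐ⁰)
    (hF : ∀ c : F, v (algebraMap F (RatFunc F) c) ≤ 1) {T G D : RatFunc F}
    (φ : RatFunc F → RatFunc F) (α : RatFunc F) (n : ℕ)
    (h : ∀ i < n, ¬ DLarge v q T G D (φ^[i] α)) (y : RatFunc F) (hy : y ∈ orbSpan φ α n) :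
    ¬ DLarge v q T G D y := by
  have hs := sq_arith hq
  induction hy using Submodule.span_induction with
  | mem x hx =>
    obtain ⟨i, hi, rfl⟩ := hx
    exact h i hi
  | zero =>
    rintro ⟨h1, -, -⟩
    rw [map_zero, zero_pow (by omega), mul_zero] at h1
    exact absurd h1 (not_lt.mpr zero_le_one)
  | add a b _ _ ha hb =>
    intro hl
    rcases v.map_add' a b with h | h
    · exact ha (dlarge_mono hq v hl h)
    · exact hb (dlarge_mono hq v hl h)
  | smul c x _ hx =>
    intro hl
    refine hx (dlarge_mono hq v hl ?_)
    rw [Algebra.smul_def, map_mul]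
    exact mul_le_of_le_one_left zero_le (hF c)

/-- Treat a finite set of finite places. -/
theorem fin_places {q : ℕ} (hqF : q = Fintype.card F) (hq : 2 ≤ q)
    {T G D : RatFunc F} (hD : D ≠ 0)
    (hT : ∀ v : HeightOneSpectrum F[X], v.valuation (RatFunc F) T ≤ 1)
    (V : Submodule F (RatFunc F)) [FiniteDimensional F V]
    (hn : ∀ v : HeightOneSpectrum F[X], ∀ y ∈ V,
      ¬ DLarge (v.valuation (RatFunc F)) q T G D (y * dmult q T G D y))
    (P : Finset F[X]) :
    ∃ V' ≤ V, (∀ v : HeightOneSpectrum F[X], (∃ p ∈ P, v.asIdeal = Ideal.span {p}) →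
      ∀ y ∈ V', v.valuation (RatFunc F) D * v.valuation (RatFunc F) y ^ (q ^ 2 - 1) ≤ 1) ∧
      Module.finrank F V ≤ Module.finrank F V' + P.card := by
  classical
  induction P using Finset.induction_on with
  | empty => exact ⟨V, le_rfl, by simp, by simp⟩
  | insert p P hp ih =>
    obtain ⟨V', hV', hgood, hr⟩ := ih
    rw [Finset.card_insert_of_notMem hp]
    by_cases hex : ∃ v : HeightOneSpectrum F[X], v.asIdeal = Ideal.span {p}
    · obtain ⟨v0, hv0⟩ := hex
      have : FiniteDimensional F V' := Submodule.finiteDimensional_of_le hV'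
      obtain ⟨V'', h1, h2, h3⟩ := fin_step hqF hq (v0.valuation (RatFunc F)) (fin_const v0) hD
        (hT v0) V' (fun y hy => hn v0 y (hV' hy))
      refine ⟨V'', h1.trans hV', ?_, by omega⟩
      rintro v ⟨p', hp', hvp⟩ y hy
      rcases Finset.mem_insert.mp hp' with rfl | hmem
      · have : v = v0 := HeightOneSpectrum.ext (hvp.trans hv0.symm)
        rw [this]; exact h2 y hy
      · exact hgood v ⟨p', hmem, hvp⟩ y (h1 hy)
    · refine ⟨V', hV', ?_, by omega⟩
      rintro v ⟨p', hp', hvp⟩ y hy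
      rcases Finset.mem_insert.mp hp' with rfl | hmem
      · exact absurd ⟨v, hvp⟩ hex
      · exact hgood v ⟨p', hmem, hvp⟩ y hy

end Assembly
/-- Lower bound for the canonical height of a non-torsion point `α ∈ 𝔽_q(T)` of the
rank 2 Drinfeld module `φ_T(y) = T·y + g·y^q + Δ·y^{q²}`: if the canonical height
`ĥ_φ(α) = lim h(φ_{T^n}(α))/q^{2n}` exists and equals `L`, then
`L > q^{−6 − 12(q² − 1)·|S|}`, where `|S| = 1 + #{monic irreducible factors of TΔ}`. -/
theorem canonical_height_lower_bound
    {Fq : Type*} [Field Fq] [Fintype Fq] [DecidableEq Fq]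
    (q : ℕ) (hq : q = Fintype.card Fq)
    (g Δ : Polynomial Fq) (hΔ : Δ ≠ 0)
    (φ : RatFunc Fq → RatFunc Fq)
    (hφ : ∀ y, φ y = RatFunc.X * y
      + algebraMap (Polynomial Fq) (RatFunc Fq) g * y ^ q
      + algebraMap (Polynomial Fq) (RatFunc Fq) Δ * y ^ q ^ 2)
    (S : ℕ) (hS : S = 1 + numMonicIrredFactors (Polynomial.X * Δ))
    (α : RatFunc Fq)
    (htor : ¬ (Set.range fun n => φ^[n] α).Finite)
    (L : ℝ)
    (hL : Tendsto
      (fun n => (max (φ^[n] α).num.natDegree (φ^[n] α).denom.natDegree : ℝ) / (q : ℝ) ^ (2 * n))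
      atTop (nhds L)) :
    L > (q : ℝ) ^ (-(6 + 12 * ((q : ℤ) ^ 2 - 1) * (S : ℤ))) := by
  classical
  have hq2 : 2 ≤ q := by rw [hq]; exact Fintype.one_lt_card
  set G := algebraMap (Polynomial Fq) (RatFunc Fq) g with hGdef
  set D := algebraMap (Polynomial Fq) (RatFunc Fq) Δ with hDdef
  have hD : D ≠ 0 := by simpa [hDdef] using hΔ
  have hφ' : ∀ y, φ y = y * dmult q RatFunc.X G D y := by
    intro y; rw [hφ, dmult_spec hq2]
  have hadd : ∀ a b : RatFunc Fq, ∀ n, (a + b) ^ q ^ n = a ^ q ^ n + b ^ q ^ n := by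
    intro a b n
    induction n with
    | zero => simp
    | succ n ih =>
      have h1 : ∀ a b : RatFunc Fq, (a + b) ^ q = a ^ q + b ^ q := by
        intro a b
        have h := frob_sub (F := Fq) hq (a + b) b
        rw [add_sub_cancel_right] at h
        rw [h]; ring
      rw [pow_succ, pow_mul, pow_mul, pow_mul, ih, h1]
  have hsm : ∀ c : Fq, ∀ n, (algebraMap Fq (RatFunc Fq) c) ^ q ^ n = algebraMap Fq (RatFunc Fq) c := by
    intro c n
    rw [← map_pow, hq, FiniteField.pow_card_pow]
  let Lm : RatFunc Fq →ₗ[Fq] RatFunc Fq :=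
    { toFun := φ
      map_add' := by
        intro a b
        have h1 := hadd a b 1
        rw [pow_one] at h1
        rw [hφ, hφ, hφ, hadd, h1]; ring
      map_smul' := by
        intro c a
        have h1 := hsm c 1
        rw [pow_one] at h1
        simp only [Algebra.smul_def, RingHom.id_apply]
        rw [hφ, hφ, mul_pow, mul_pow, hsm, h1]; ring }
  have hLm : (Lm : RatFunc Fq → RatFunc Fq) = φ := rfl
  by_contra hcon
  rw [gt_iff_lt, not_lt] at hcon
  -- no early iterate is large
  have hnl : ∀ v : Valuation (RatFunc Fq) (WithZero (Multiplicative ℤ)),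
      (∀ x, v x ≤ WithZero.exp (nht x : ℤ)) →
      ∀ i < S + 4, ¬ DLarge v q RatFunc.X G D (φ^[i] α) := by
    intro v hv i hi hl
    have hb := limit_bound hq2 (fun n => nht (φ^[n] α)) (nht D) i L
      (by
        refine hL.congr (fun n => ?_)
        simp [nht])
      (by
        intro m
        have := growth hq2 v hv hφ' hl m
        rw [← Function.iterate_add_apply] at this
        exact this)
    have hq1 : (1 : ℝ) < q := by exact_mod_cast (by omega : 1 < q)
    have hb2 : (q : ℝ) ^ (-(2 * (i : ℤ) + 2)) < L := by
      refine lt_of_lt_of_le ?_ hb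
      have : (q : ℝ) ^ (-(2 * (i : ℤ) + 2)) = 1 / ((q : ℝ) ^ 2 * (q : ℝ) ^ (2 * i)) := by
        rw [zpow_neg, one_div, ← pow_add, ← zpow_natCast]
        congr 2; push_cast; ring
      rw [this]
      have : (0 : ℝ) < (q : ℝ) ^ 2 - 1 := by nlinarith
      apply one_div_lt_one_div_of_lt (by positivity)
      gcongr
      linarith
    have hb3 := hb2.trans_le hcon
    rw [zpow_lt_zpow_iff_right₀ hq1] at hb3
    have hq4 : (4 : ℤ) ≤ (q : ℤ) ^ 2 := by
      have : (2 : ℤ) ≤ q := by exact_mod_cast hq2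
      nlinarith
    have hS1 : (1 : ℤ) ≤ S := by rw [hS]; push_cast; omega
    have hi' : (i : ℤ) < S + 4 := by exact_mod_cast hi
    nlinarith
  set N := S + 3 with hN
  have hstep : ∀ v : Valuation (RatFunc Fq) (WithZero (Multiplicative ℤ)),
      (∀ x, v x ≤ WithZero.exp (nht x : ℤ)) →
      (∀ c : Fq, v (algebraMap Fq (RatFunc Fq) c) ≤ 1) →
      ∀ y ∈ orbSpan φ α N, ¬ DLarge v q RatFunc.X G D (y * dmult q RatFunc.X G D y) := by
    intro v hv hF y hy
    rw [← hφ']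
    exact orbSpan_not_large hq2 v hF φ α (N + 1) (hnl v hv) _ (orbSpan_map Lm α N y hy)
  have hfd := orbSpan_fd φ α N
  have hrank : N ≤ Module.finrank Fq (orbSpan φ α N) := orbSpan_rank Lm α htor N
  have hXfin : ∀ v : IsDedekindDomain.HeightOneSpectrum Fq[X],
      v.valuation (RatFunc Fq) RatFunc.X ≤ 1 := by
    intro v
    rw [← RatFunc.algebraMap_X]
    exact v.valuation_le_one _
  have hfinstep := fun v : IsDedekindDomain.HeightOneSpectrum Fq[X] =>
    hstep (v.valuation (RatFunc Fq)) (fin_val_le v) (fin_const v)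
  have hXΔ : Polynomial.X * Δ ≠ 0 := mul_ne_zero X_ne_zero hΔ
  obtain ⟨V1, hV1, hgood1, hr1⟩ := fin_places hq hq2 hD hXfin (orbSpan φ α N) hfinstep
    (normalizedFactors (Polynomial.X * Δ)).toFinset
  have hcard : S = 1 + (normalizedFactors (Polynomial.X * Δ)).toFinset.card := by
    rw [hS, numMonicIrredFactors]
    congr!
  have hfd1 : FiniteDimensional Fq V1 := Submodule.finiteDimensional_of_le hV1
  obtain ⟨V2, hV2, hgood2, hr2⟩ := infty_place hq2 (RatFunc.inftyValuation Fq) infty_const infty_res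
    hD (T := RatFunc.X) (G := G) (by
      rw [RatFunc.inftyValuation.X, ← WithZero.exp_zero, WithZero.exp_lt_exp]; norm_num) V1
    (fun y hy => hstep _ infty_val_le infty_const y (hV1 hy))
  have hpos : 0 < Module.finrank Fq V2 := by omega
  have hne : V2 ≠ ⊥ := by
    rintro rfl
    simp at hpos
  obtain ⟨y, hy, hy0⟩ := (Submodule.ne_bot_iff _).mp hne
  -- all finite places are fine
  have hfinal : ∀ v : IsDedekindDomain.HeightOneSpectrum Fq[X],
      v.valuation (RatFunc Fq) (D * y ^ (q ^ 2 - 1)) ≤ 1 := by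
    intro v
    rw [map_mul, map_pow]
    by_cases hDv : v.valuation (RatFunc Fq) D = 1
    · exact fin_good hq2 (v.valuation (RatFunc Fq)) hDv (hXfin v) (v.valuation_le_one g)
        (hfinstep v y (hV1 (hV2 hy)))
    · refine hgood1 v ?_ y (hV2 hy)
      have hlt : v.valuation (RatFunc Fq) D < 1 := lt_of_le_of_ne (v.valuation_le_one Δ) hDv
      have hmem : Δ ∈ v.asIdeal := (v.valuation_lt_one_iff_mem Δ).mp hlt
      obtain ⟨p, hp⟩ := (IsPrincipalIdealRing.principal v.asIdeal).principal
      have hp' : v.asIdeal = Ideal.span {p} := hp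
      have hp0 : p ≠ 0 := by
        rintro rfl
        exact v.ne_bot (by simpa using hp')
      have hprime : Prime p := by
        rw [← Ideal.span_singleton_prime hp0, ← hp']
        exact v.isPrime
      have hdvd : p ∣ Polynomial.X * Δ := by
        rw [hp', Ideal.mem_span_singleton] at hmem
        exact hmem.mul_left _
      obtain ⟨p', hp'mem, hassoc⟩ := exists_mem_normalizedFactors_of_dvd hXΔ hprime.irreducible hdvd
      exact ⟨p', Multiset.mem_toFinset.mpr hp'mem,
        hp'.trans (Ideal.span_singleton_eq_span_singleton.mpr hassoc)⟩
  obtain ⟨f, hf⟩ := IsDedekindDomain.HeightOneSpectrum.mem_integers_of_valuation_le_one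
    (RatFunc Fq) _ hfinal
  have hz : D * y ^ (q ^ 2 - 1) ≠ 0 := mul_ne_zero hD (pow_ne_zero _ hy0)
  have hf0 : f ≠ 0 := by
    rintro rfl
    rw [map_zero] at hf
    exact hz hf.symm
  have h1 := hgood2 y hy
  rw [← map_pow, ← map_mul, ← hf, infty_val_poly hf0, ← WithZero.exp_zero, WithZero.exp_lt_exp] at h1
  omega
end

section
/- Let N ≥ 1 and regard 𝔽_q as a subfield of 𝔽_{q^N}, inducing an inclusion 𝔽_q[T] ⊆ 𝔽_{q^N}[T]. Let (A_i)_{i ≥ 0} be a sequence of polynomials in 𝔽_q[T] and let n ≥ 1. Then there exists an irreducible 𝔭 ∈ 𝔽_q[T] with 𝔭 ∣ A_n and 𝔭 ∤ A_i for all 0 ≤ i < n if and only if there exists an irreducible 𝔮 ∈ 𝔽_{q^N}[T] with 𝔮 ∣ A_n and 𝔮 ∤ A_i for all 0 ≤ i < n, where in the second case divisibility is taken in 𝔽_{q^N}[T]. (Consequently, Zsigmondy sets are unchanged under the constant field extension 𝔽_q ⊆ 𝔽_{q^N}.) -/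
/-- Primitive divisors are unchanged under the constant field extension `𝔽_q ⊆ 𝔽_{q^N}`:
for a sequence `(A_i)` in `𝔽_q[T]` and `n ≥ 1`, `A_n` has an irreducible primitive divisor
in `𝔽_q[T]` if and only if it has one in `𝔽_{q^N}[T]`. Consequently the Zsigmondy sets
over `𝔽_q` and over `𝔽_{q^N}` coincide. -/
theorem primitive_divisor_iff_constant_field_extension
    {Fq FqN : Type*} [Field Fq] [Fintype Fq] [Field FqN] [Fintype FqN]
    [Algebra Fq FqN]
    (N : ℕ) (hN : 1 ≤ N) (hcard : Fintype.card FqN = Fintype.card Fq ^ N)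
    (A : ℕ → Polynomial Fq) (n : ℕ) (hn : 1 ≤ n) :
    (∃ p : Polynomial Fq, Irreducible p ∧ p ∣ A n ∧ ∀ i < n, ¬ p ∣ A i) ↔
    (∃ P : Polynomial FqN, Irreducible P ∧
      P ∣ (A n).map (algebraMap Fq FqN) ∧ ∀ i < n, ¬ P ∣ (A i).map (algebraMap Fq FqN)) := by
  constructor
  · rintro ⟨p, hp, hpn, hpi⟩
    have hu : ¬ IsUnit (p.map (algebraMap Fq FqN)) := by
      rw [Polynomial.isUnit_map]
      exact hp.not_isUnit
    obtain ⟨P, hP, hPp⟩ := WfDvdMonoid.exists_irreducible_factor hu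
      (Polynomial.map_ne_zero hp.ne_zero)
    refine ⟨P, hP, hPp.trans (Polynomial.map_dvd _ hpn), fun i hi h => ?_⟩
    have hc : IsCoprime p (A i) := (hp.coprime_iff_not_dvd).2 (hpi i hi)
    have hc' := hc.map (Polynomial.mapRingHom (algebraMap Fq FqN))
    exact hP.not_isUnit (hc'.isUnit_of_dvd' hPp h)
  · rintro ⟨P, hP, hPn, hPi⟩
    haveI : Fact (Irreducible P) := ⟨hP⟩
    haveI : Module.Finite Fq FqN := Module.Finite.of_finite
    have hint : IsIntegral Fq (AdjoinRoot.root P) :=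
      isIntegral_trans (R := Fq) (A := FqN) _ (AdjoinRoot.isAlgebraic_root hP.ne_zero).isIntegral
    have key : ∀ B : Polynomial Fq,
        minpoly Fq (AdjoinRoot.root P) ∣ B ↔ P ∣ B.map (algebraMap Fq FqN) := by
      intro B
      rw [minpoly.dvd_iff, ← AdjoinRoot.mk_eq_zero, ← AdjoinRoot.aeval_eq,
        Polynomial.aeval_map_algebraMap]
    exact ⟨minpoly Fq (AdjoinRoot.root P), minpoly.irreducible hint, (key _).2 hPn,
      fun i hi h => hPi i hi ((key _).1 h)⟩
end

section
/- Let φ_T(x) = T·x + c_1·x^q + ⋯ + c_r·x^{q^r} with c_1, …, c_r ∈ 𝔽_q[T], c_r ≠ 0, set Θ = q^r and m_φ = (q/(q − 1))·max{1 − deg c_r, deg c_1 − deg c_r, …, deg c_{r−1} − deg c_r, 0}. Then for every x ∈ 𝔽_q[T]: Θ·h(x) − h(φ_T(x)) ≤ m_φ. -/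
open Polynomial

/-- One-step height bound: for `φ_T(y) = T·y + c_1·y^q + ⋯ + c_r·y^{q^r}`,
`Θ = q^r` and `m_φ = (q/(q − 1))·max{1 − deg c_r, deg c_1 − deg c_r, …, deg c_{r−1} − deg c_r, 0}`,
every `x ∈ 𝔽_q[T]` satisfies `Θ·h(x) − h(φ_T(x)) ≤ m_φ`. -/
theorem theta_height_sub_height_phi_le
    {Fq : Type*} [Field Fq] [Fintype Fq]
    (q : ℕ) (hq : q = Fintype.card Fq)
    (r : ℕ) (hr : 1 ≤ r) (c : ℕ → Polynomial Fq) (hcr : c r ≠ 0)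
    (φ : Polynomial Fq → Polynomial Fq)
    (hφ : ∀ y, φ y = Polynomial.X * y + ∑ i ∈ Finset.range r, c (i + 1) * y ^ q ^ (i + 1))
    (Θ : ℕ) (hΘ : Θ = q ^ r)
    (mφ : ℝ)
    (hm : mφ = ((q : ℝ) / ((q : ℝ) - 1))
      * (((((Finset.range r).sup fun i =>
          ((if i = 0 then (1 : ℤ) else ((c i).natDegree : ℤ)) - ((c r).natDegree : ℤ)).toNat) : ℕ)) : ℝ))
    (x : Polynomial Fq) :
    (Θ : ℝ) * (x.natDegree : ℝ) - ((φ x).natDegree : ℝ) ≤ mφ := by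
  classical
  have hq2 : 2 ≤ q := hq ▸ Fintype.one_lt_card
  have hqr : (2 : ℝ) ≤ q := by exact_mod_cast hq2
  set M : ℕ := (Finset.range r).sup fun i =>
          ((if i = 0 then (1 : ℤ) else ((c i).natDegree : ℤ)) - ((c r).natDegree : ℤ)).toNat with hM
  have hm0 : 0 ≤ mφ := by
    rw [hm]
    exact mul_nonneg (div_nonneg (by linarith) (by linarith)) (Nat.cast_nonneg _)
  have hMle : ∀ i < r, (if i = 0 then 1 else (c i).natDegree) ≤ (c r).natDegree + M := by
    intro i hi
    have h := Finset.le_sup (f := fun i =>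
      ((if i = 0 then (1 : ℤ) else ((c i).natDegree : ℤ)) - ((c r).natDegree : ℤ)).toNat)
      (Finset.mem_range.2 hi)
    rw [← hM] at h
    split_ifs at h ⊢ <;> omega
  by_cases hcase : (Θ : ℝ) * x.natDegree ≤ mφ
  · have : (0 : ℝ) ≤ (φ x).natDegree := Nat.cast_nonneg _
    linarith
  · push Not at hcase
    have key : (q : ℝ) * M < (q - 1) * ((q : ℝ) ^ r * x.natDegree) := by
      rw [hm, hΘ, div_mul_eq_mul_div, div_lt_iff₀ (by linarith)] at hcase
      push_cast at hcase
      linarith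
    have hx : x ≠ 0 := by
      rintro rfl
      simp at hcase
      linarith
    have hlt : ∀ i < r, M + q ^ i * x.natDegree < q ^ r * x.natDegree := by
      intro i hi
      have h1 : (q : ℝ) * q ^ i ≤ q ^ r := by
        rw [← pow_succ']
        exact pow_le_pow_right₀ (by linarith) hi
      have h2 := mul_le_mul_of_nonneg_right h1 (Nat.cast_nonneg (α := ℝ) x.natDegree)
      have h3 : (q : ℝ) * (M + q ^ i * x.natDegree) < q * (q ^ r * x.natDegree) := by
        linarith
      have h4 := lt_of_mul_lt_mul_left h3 (by linarith)
      exact_mod_cast h4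
    obtain ⟨s, rfl⟩ : ∃ s, r = s + 1 := ⟨r - 1, by omega⟩
    have hmain : (c (s + 1) * x ^ q ^ (s + 1)).natDegree
        = (c (s + 1)).natDegree + q ^ (s + 1) * x.natDegree := by
      rw [natDegree_mul hcr (pow_ne_zero _ hx), natDegree_pow]
    set N := (c (s + 1)).natDegree + q ^ (s + 1) * x.natDegree with hN
    have hb0 : (X * x).natDegree ≤ N - 1 := by
      have h1 := hMle 0 hr
      have h2 := hlt 0 hr
      rw [natDegree_X_mul hx]
      simp at h1 h2
      omega
    have hb : ∀ i ∈ Finset.range s, (c (i + 1) * x ^ q ^ (i + 1)).natDegree ≤ N - 1 := by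
      intro i hi
      have hi' : i + 1 < s + 1 := by simpa using hi
      have h1 := hMle _ hi'
      have h2 := hlt _ hi'
      have h3 := natDegree_mul_le (p := c (i + 1)) (q := x ^ q ^ (i + 1))
      rw [natDegree_pow] at h3
      simp at h1
      omega
    have hlow : (X * x + ∑ i ∈ Finset.range s, c (i + 1) * x ^ q ^ (i + 1)).natDegree ≤ N - 1 :=
      natDegree_add_le_of_degree_le hb0 (natDegree_sum_le_of_forall_le _ _ hb)
    have hNpos : 0 < N := by
      have h2 := hlt 0 hr
      omega
    have hdeg : (φ x).natDegree = N := by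
      rw [hφ, Finset.sum_range_succ, ← add_assoc,
        natDegree_add_eq_right_of_natDegree_lt (by rw [hmain]; omega), hmain]
    have : Θ * x.natDegree ≤ (φ x).natDegree := by
      rw [hdeg, hΘ]; omega
    have : (Θ : ℝ) * x.natDegree ≤ (φ x).natDegree := by exact_mod_cast this
    linarith
end

section
/- Let φ_T(x) = T·x + c_1·x^q + ⋯ + c_r·x^{q^r} with c_1, …, c_r ∈ 𝔽_q[T], c_r ≠ 0, set Θ = q^r and M_φ = (q/((Θ − 1)(q − 1)))·max{1 − deg c_r, deg c_1 − deg c_r, …, deg c_{r−1} − deg c_r, 0}. Then for every x ∈ 𝔽_q[T] and every n ≥ 1: h(x) − h(φ_{T^n}(x))/Θ^n ≤ M_φ. -/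
open Polynomial

/-- Iterated height bound: for `φ_T(y) = T·y + c_1·y^q + ⋯ + c_r·y^{q^r}`, `Θ = q^r` and
`M_φ = (q/((Θ − 1)(q − 1)))·max{1 − deg c_r, deg c_1 − deg c_r, …, deg c_{r−1} − deg c_r, 0}`,
every `x ∈ 𝔽_q[T]` and `n ≥ 1` satisfy `h(x) − h(φ_{T^n}(x))/Θ^n ≤ M_φ`. -/
theorem height_sub_iterate_height_div_le
    {Fq : Type*} [Field Fq] [Fintype Fq]
    (q : ℕ) (hq : q = Fintype.card Fq)
    (r : ℕ) (hr : 1 ≤ r) (c : ℕ → Polynomial Fq) (hcr : c r ≠ 0)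
    (φ : Polynomial Fq → Polynomial Fq)
    (hφ : ∀ y, φ y = Polynomial.X * y + ∑ i ∈ Finset.range r, c (i + 1) * y ^ q ^ (i + 1))
    (Θ : ℕ) (hΘ : Θ = q ^ r)
    (Mφ : ℝ)
    (hM : Mφ = (q : ℝ) / (((Θ : ℝ) - 1) * ((q : ℝ) - 1))
      * (((((Finset.range r).sup fun i =>
          ((if i = 0 then (1 : ℤ) else ((c i).natDegree : ℤ)) - ((c r).natDegree : ℤ)).toNat) : ℕ)) : ℝ))
    (x : Polynomial Fq) (n : ℕ) (hn : 1 ≤ n) :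
    (x.natDegree : ℝ) - ((φ^[n] x).natDegree : ℝ) / (Θ : ℝ) ^ n ≤ Mφ := by
  have hq2 : 2 ≤ q := by rw [hq]; exact Fintype.one_lt_card
  obtain ⟨s, rfl⟩ : ∃ s, r = s + 1 := ⟨r - 1, by omega⟩
  set m : ℕ := (Finset.range (s + 1)).sup fun i =>
          ((if i = 0 then (1 : ℤ) else ((c i).natDegree : ℤ)) - ((c (s + 1)).natDegree : ℤ)).toNat
    with hm
  have hmi : ∀ i ∈ Finset.range (s + 1), ((if i = 0 then (1 : ℤ) else ((c i).natDegree : ℤ))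
      - ((c (s + 1)).natDegree : ℤ)).toNat ≤ m := fun i hi =>
    Finset.le_sup (f := fun i => ((if i = 0 then (1 : ℤ) else ((c i).natDegree : ℤ))
      - ((c (s + 1)).natDegree : ℤ)).toNat) hi
  have hm0 : 1 ≤ m + (c (s + 1)).natDegree := by
    have := hmi 0 (by simp)
    simp only [if_true] at this
    omega
  have hmc : ∀ i < s, (c (i + 1)).natDegree ≤ m + (c (s + 1)).natDegree := by
    intro i hi
    have := hmi (i + 1) (by simp; omega)
    simp only [Nat.succ_ne_zero, if_false] at this
    omega
  clear_value m
  have hk1 : 1 ≤ q ^ s := Nat.one_le_pow _ _ (by omega)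
  have hΘk : Θ = q * q ^ s := by rw [hΘ, pow_succ, mul_comm]
  have hΘ1 : 2 ≤ Θ := by rw [hΘk]; nlinarith
  -- degree of `φ y` above the threshold
  have key : ∀ y : Polynomial Fq, m + q ^ s * y.natDegree < Θ * y.natDegree →
      Θ * y.natDegree ≤ (φ y).natDegree := by
    intro y hy
    have hlead : (c (s + 1) * y ^ q ^ (s + 1)).natDegree
        = (c (s + 1)).natDegree + Θ * y.natDegree := by
      have hy0 : y ≠ 0 := by
        rintro rfl
        simp at hy
      rw [natDegree_mul hcr (pow_ne_zero _ hy0), natDegree_pow, hΘ]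
    have hrest : (X * y + ∑ i ∈ Finset.range s, c (i + 1) * y ^ q ^ (i + 1)).natDegree
        ≤ m + (c (s + 1)).natDegree + q ^ s * y.natDegree := by
      apply natDegree_add_le_of_degree_le
      · refine natDegree_mul_le.trans ?_
        have h1 : (X : Polynomial Fq).natDegree ≤ 1 := natDegree_X_le
        nlinarith
      · apply natDegree_sum_le_of_forall_le
        intro i hi
        rw [Finset.mem_range] at hi
        refine natDegree_mul_le.trans ?_
        refine add_le_add (hmc i hi) (natDegree_pow_le.trans ?_)
        exact Nat.mul_le_mul_right _ (Nat.pow_le_pow_right (by omega) (by omega))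
    rw [hφ, Finset.sum_range_succ, ← add_assoc,
      natDegree_add_eq_right_of_natDegree_lt (by rw [hlead]; omega), hlead]
    omega
  have iter : ∀ (n : ℕ) (y : Polynomial Fq), m + q ^ s * y.natDegree < Θ * y.natDegree →
      Θ ^ n * y.natDegree ≤ (φ^[n] y).natDegree := by
    intro n
    induction n with
    | zero => intro y _; simp
    | succ n ih =>
      intro y hy
      have h1 := key y hy
      rw [Function.iterate_succ_apply]
      refine le_trans ?_ (ih (φ y) ?_)
      · rw [pow_succ, mul_assoc]
        exact Nat.mul_le_mul_left _ h1
      · have h2 : y.natDegree ≤ (φ y).natDegree := by nlinarith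
        have h3 : q ^ s ≤ Θ := by rw [hΘk]; nlinarith
        obtain ⟨d, hd⟩ := Nat.exists_eq_add_of_le h2
        rw [hd]
        have := Nat.mul_le_mul_right d h3
        rw [mul_add, mul_add]
        omega
  have hqR : (2 : ℝ) ≤ q := by exact_mod_cast hq2
  have hΘR : (2 : ℝ) ≤ Θ := by exact_mod_cast hΘ1
  have hpos : (0 : ℝ) < ((Θ : ℝ) - 1) * ((q : ℝ) - 1) := by
    apply mul_pos <;> linarith
  by_cases h : m + q ^ s * x.natDegree < Θ * x.natDegree
  · have h1 : (Θ : ℝ) ^ n * x.natDegree ≤ (φ^[n] x).natDegree := by exact_mod_cast iter n x h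
    have h2 : (x.natDegree : ℝ) ≤ ((φ^[n] x).natDegree : ℝ) / (Θ : ℝ) ^ n := by
      rw [le_div_iff₀ (by positivity)]
      linarith
    have h3 : 0 ≤ Mφ := by rw [hM]; positivity
    linarith
  · have h1 : (Θ : ℝ) * x.natDegree ≤ m + (q : ℝ) ^ s * x.natDegree := by
      exact_mod_cast not_lt.mp h
    have h2 : (x.natDegree : ℝ) ≤ Mφ := by
      rw [hM, div_mul_eq_mul_div, le_div_iff₀ hpos]
      have h3 : (Θ : ℝ) = q * (q : ℝ) ^ s := by exact_mod_cast hΘk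
      have h4 := mul_le_mul_of_nonneg_left h1 (by linarith : (0 : ℝ) ≤ q)
      have h5 : (0 : ℝ) ≤ x.natDegree * ((q : ℝ) - 1) := by
        apply mul_nonneg (by positivity); linarith
      have h6 : (q : ℝ) * ((q : ℝ) ^ s * x.natDegree) = Θ * x.natDegree := by rw [h3]; ring
      rw [mul_add, h6] at h4
      linarith
    have h3 : (0 : ℝ) ≤ ((φ^[n] x).natDegree : ℝ) / (Θ : ℝ) ^ n := by positivity
    linarith
end

section
/- Let φ_T(x) = T·x + c_1·x^q + ⋯ + c_r·x^{q^r} with c_1, …, c_r ∈ 𝔽_q[T], c_r ≠ 0, set Θ = q^r and M′_φ = (1/(Θ − 1))·max{1, deg c_1, …, deg c_r}. Then for every x ∈ 𝔽_q[T] and every n ≥ 1: h(φ_{T^n}(x))/Θ^n − h(x) ≤ M′_φ. -/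
open Polynomial

/-- Iterated height bound: for `φ_T(y) = T·y + c_1·y^q + ⋯ + c_r·y^{q^r}`, `Θ = q^r` and
`M′_φ = (1/(Θ − 1))·max{1, deg c_1, …, deg c_r}`, every `x ∈ 𝔽_q[T]` and `n ≥ 1`
satisfy `h(φ_{T^n}(x))/Θ^n − h(x) ≤ M′_φ`. -/
theorem iterate_height_div_sub_height_le
    {Fq : Type*} [Field Fq] [Fintype Fq]
    (q : ℕ) (hq : q = Fintype.card Fq)
    (r : ℕ) (hr : 1 ≤ r) (c : ℕ → Polynomial Fq) (hcr : c r ≠ 0)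
    (φ : Polynomial Fq → Polynomial Fq)
    (hφ : ∀ y, φ y = Polynomial.X * y + ∑ i ∈ Finset.range r, c (i + 1) * y ^ q ^ (i + 1))
    (Θ : ℕ) (hΘ : Θ = q ^ r)
    (M'φ : ℝ)
    (hM' : M'φ = (1 / ((Θ : ℝ) - 1))
      * ((((Finset.range (r + 1)).sup fun i => if i = 0 then 1 else (c i).natDegree : ℕ)) : ℝ))
    (x : Polynomial Fq) (n : ℕ) (hn : 1 ≤ n) :
    ((φ^[n] x).natDegree : ℝ) / (Θ : ℝ) ^ n - (x.natDegree : ℝ) ≤ M'φ := by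
  have hq2 : 2 ≤ q := by
    rw [hq]
    exact Fintype.one_lt_card
  have hΘ2 : 2 ≤ Θ := by
    rw [hΘ]
    exact hq2.trans (Nat.le_self_pow (by omega) q)
  set D : ℕ := (Finset.range (r + 1)).sup fun i => if i = 0 then 1 else (c i).natDegree with hD
  have hle : ∀ i ∈ Finset.range (r + 1), (if i = 0 then 1 else (c i).natDegree) ≤ D :=
    fun i hi => Finset.le_sup (f := fun i => if i = 0 then 1 else (c i).natDegree) hi
  have hD1 : 1 ≤ D := by
    have := hle 0 (by simp)
    simpa using this
  have step : ∀ y, (φ y).natDegree ≤ Θ * y.natDegree + D := by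
    intro y
    rw [hφ]
    refine (natDegree_add_le _ _).trans (max_le ?_ ?_)
    · refine natDegree_mul_le.trans ?_
      rw [natDegree_X]
      nlinarith [Nat.zero_le y.natDegree]
    · refine natDegree_sum_le_of_forall_le _ _ ?_
      intro i hi
      have hi' : i < r := Finset.mem_range.mp hi
      have h1 : (c (i + 1)).natDegree ≤ D := by
        have := hle (i + 1) (Finset.mem_range.mpr (by omega))
        simpa using this
      have h2 : q ^ (i + 1) ≤ Θ := by
        rw [hΘ]
        exact Nat.pow_le_pow_right (by omega) (by omega)
      have h3 : (y ^ q ^ (i + 1)).natDegree ≤ q ^ (i + 1) * y.natDegree := natDegree_pow_le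
      have h4 := Nat.mul_le_mul_right y.natDegree h2
      refine natDegree_mul_le.trans ?_
      omega
  have hΘr : (2 : ℝ) ≤ (Θ : ℝ) := by exact_mod_cast hΘ2
  have hpos : (0 : ℝ) < (Θ : ℝ) - 1 := by linarith
  have hMeq : M'φ * (Θ : ℝ) = M'φ + (D : ℝ) := by
    rw [hM']
    field_simp
    ring
  have hM0 : 0 ≤ M'φ := by
    rw [hM']
    positivity
  have key : ∀ m : ℕ, ((φ^[m] x).natDegree : ℝ) + M'φ
      ≤ (Θ : ℝ) ^ m * ((x.natDegree : ℝ) + M'φ) := by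
    intro m
    induction m with
    | zero => simp
    | succ k ih =>
      rw [Function.iterate_succ_apply']
      have h1 : ((φ (φ^[k] x)).natDegree : ℝ) ≤ (Θ : ℝ) * ((φ^[k] x).natDegree : ℝ) + (D : ℝ) := by
        exact_mod_cast step (φ^[k] x)
      have h2 := mul_le_mul_of_nonneg_left ih (by linarith : (0 : ℝ) ≤ (Θ : ℝ))
      rw [pow_succ]
      linarith
  have hp : (0 : ℝ) < (Θ : ℝ) ^ n := by positivity
  rw [sub_le_iff_le_add, div_le_iff₀ hp]
  have := key n
  linarith
end
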